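/- Let H be a unicyclic graph with cycle C_n where n ≡ 2 (mod 3), and G = H_T obtained by attaching unions of complete graphs at vertices of T ⊆ V(H). Write G as C_n with chordal graphs G_1,...,G_m attached at vertices y_{i_1},...,y_{i_m} of C_n, and let Γ(G) = ∪_j N_{G_j}(y_{i_j}). If ν(G ∖ Γ(G)) < ν(G), then reg(S/I(G)) = ν(G). -/

import Mathlib

open MvPolynomial

noncomputable section

namespace EdgeIdealReg

open scoped Classical

/-- The edge ideal of a simple graph, in the polynomial ring with variables the vertices. -/
def edgeIdeal (K : Type) [Field K] {V : Type} (G : SimpleGraph V) :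
    Ideal (MvPolynomial V K) :=
  Ideal.span { p | ∃ u v : V, G.Adj u v ∧ p = X u * X v }

/-- The edge ideal of the induced subgraph on a set `s` of vertices, viewed inside the
polynomial ring of the ambient graph (extra variables do not change the regularity). -/
def edgeIdealOn (K : Type) [Field K] {V : Type} (G : SimpleGraph V) (s : Set V) :
    Ideal (MvPolynomial V K) :=
  Ideal.span { p | ∃ u v : V, G.Adj u v ∧ u ∈ s ∧ v ∈ s ∧ p = X u * X v }

/-- The `r`-th symbolic power of an ideal: the intersection over all minimal primes `p` of `I`
of the contraction of `I^r` localized at `p`; concretely,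
`f ∈ I^{(r)}` iff for every minimal prime `p` of `I` there is `s ∉ p` with `s * f ∈ I ^ r`. -/
def symbolicPower {R : Type} [CommRing R] (I : Ideal R) (r : ℕ) : Ideal R where
  carrier := { f | ∀ p ∈ I.minimalPrimes, ∃ s, s ∉ p ∧ s * f ∈ I ^ r }
  zero_mem' := by
    intro p hp
    exact ⟨1, (Ideal.ne_top_iff_one p).mp hp.1.1.ne_top, by simp⟩
  add_mem' := by
    intro a b ha hb p hp
    obtain ⟨s, hs, hsa⟩ := ha p hp
    obtain ⟨t, ht, htb⟩ := hb p hp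
    refine ⟨s * t, fun h => ?_, ?_⟩
    · rcases hp.1.1.mem_or_mem h with h' | h'
      · exact hs h'
      · exact ht h'
    · have : s * t * (a + b) = t * (s * a) + s * (t * b) := by ring
      rw [this]
      exact Ideal.add_mem _ (Ideal.mul_mem_left _ _ hsa) (Ideal.mul_mem_left _ _ htb)
  smul_mem' := by
    intro c f hf p hp
    obtain ⟨s, hs, hsf⟩ := hf p hp
    refine ⟨s, hs, ?_⟩
    have : s * (c • f) = c * (s * f) := by
      simp only [smul_eq_mul]; ring
    rw [this]
    exact Ideal.mul_mem_left _ _ hsf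

/-- Symbolic power with an integer exponent, with the convention `I^{(k)} = S` for `k ≤ 0`. -/
def symbolicPowerZ {R : Type} [CommRing R] (I : Ideal R) (k : ℤ) : Ideal R :=
  if k ≤ 0 then ⊤ else symbolicPower I k.toNat

/-- A graded free resolution of `S/I` over the polynomial ring `S = K[x_v]`:
`⋯ → F_{i+1} → F_i → ⋯ → F_0 = S → S/I → 0`, where `F_i` is a graded free module with
basis elements of degrees `deg i k`, the differentials are given by matrices of homogeneous
polynomials of the appropriate degrees, the image of `F_1 → F_0 = S` is `I`, and the
complex is exact in positive homological degrees. -/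
structure GradedFreeResolution {K : Type} [Field K] {σ : Type}
    (I : Ideal (MvPolynomial σ K)) where
  rank : ℕ → ℕ
  deg : (i : ℕ) → Fin (rank i) → ℕ
  rank_zero : rank 0 = 1
  deg_zero : ∀ k, deg 0 k = 0
  mat : (i : ℕ) → Matrix (Fin (rank i)) (Fin (rank (i + 1))) (MvPolynomial σ K)
  homog : ∀ i k j, mat i k j = 0 ∨
    ∃ e, deg (i + 1) j = deg i k + e ∧ (mat i k j).IsHomogeneous e
  range_zero : ∀ f : MvPolynomial σ K,
    f ∈ I ↔ (fun _ => f) ∈ LinearMap.range (Matrix.mulVecLin (mat 0))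
  isExact : ∀ i, LinearMap.ker (Matrix.mulVecLin (mat i)) =
    LinearMap.range (Matrix.mulVecLin (mat (i + 1)))

/-- The Castelnuovo–Mumford regularity of the quotient `S/I` for a homogeneous ideal `I` of
the polynomial ring: the least `d` such that some graded free resolution of `S/I` has all its
`i`-th syzygies generated in degrees `≤ d + i` (the minimal free resolution realizes the
infimum).  By convention `reg (S/S) = ⊥ = -∞`. -/

def regQuot {K : Type} [Field K] {σ : Type} (I : Ideal (MvPolynomial σ K)) : WithBot ℤ :=
  if I = ⊤ then ⊥
  else ((sInf { d : ℤ | ∃ F : GradedFreeResolution I,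
      ∀ i (k : Fin (F.rank i)), (F.deg i k : ℤ) ≤ d + i } : ℤ) : WithBot ℤ)

/-- A set of edges of `G` that forms a matching: pairwise disjoint edges. -/
def IsMatchingSet {V : Type} (G : SimpleGraph V) (M : Finset (Sym2 V)) : Prop :=
  (M : Set (Sym2 V)) ⊆ G.edgeSet ∧
    (M : Set (Sym2 V)).Pairwise fun e f => ∀ v, v ∈ e → v ∉ f

/-- An induced matching: a matching such that no two of its edges are joined by an edge
of `G`, i.e. it is the edge set of an induced subgraph. -/
def IsInducedMatchingSet {V : Type} (G : SimpleGraph V) (M : Finset (Sym2 V)) : Prop :=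
  IsMatchingSet G M ∧
    (M : Set (Sym2 V)).Pairwise fun e f => ∀ u v, u ∈ e → v ∈ f → ¬G.Adj u v

/-- The matching number `mat(G)`. -/
def matchingNumber {V : Type} (G : SimpleGraph V) : ℕ :=
  sSup { n | ∃ M, IsMatchingSet G M ∧ M.card = n }

/-- The induced matching number `ν(G)`. -/
def inducedMatchingNumber {V : Type} (G : SimpleGraph V) : ℕ :=
  sSup { n | ∃ M, IsInducedMatchingSet G M ∧ M.card = n }

/-- `G` has an induced cycle of length `n`. -/
def HasInducedCycle {V : Type} (G : SimpleGraph V) (n : ℕ) : Prop :=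
  ∃ f : ZMod n → V, Function.Injective f ∧
    ∀ i j : ZMod n, G.Adj (f i) (f j) ↔ (j = i + 1 ∨ i = j + 1)

/-- A graph is chordal if every induced cycle has length `3`. -/
def Chordal {V : Type} (G : SimpleGraph V) : Prop :=
  ∀ n, 4 ≤ n → ¬HasInducedCycle G n

/-- A graph is weakly chordal if every induced cycle in `G` and in `Gᶜ` has length at most 4. -/
def WeaklyChordal {V : Type} (G : SimpleGraph V) : Prop :=
  (∀ n, 5 ≤ n → ¬HasInducedCycle G n) ∧ ∀ n, 5 ≤ n → ¬HasInducedCycle Gᶜ n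

/-- The co-chordal cover number `cochord(G)`: the least `n` such that `n` co-chordal
subgraphs of `G` cover all the edges of `G`. -/
def cochordNumber {V : Type} (G : SimpleGraph V) : ℕ :=
  sInf { n | ∃ H : Fin n → SimpleGraph V,
    (∀ i, H i ≤ G ∧ Chordal (H i)ᶜ) ∧ ∀ e ∈ G.edgeSet, ∃ i, e ∈ (H i).edgeSet }

/-- A graph is unicyclic if it contains exactly one cycle. -/
def Unicyclic {V : Type} (G : SimpleGraph V) : Prop :=
  ∃ (v : V) (c : G.Walk v v), c.IsCycle ∧
    ∀ (w : V) (c' : G.Walk w w), c'.IsCycle → { e | e ∈ c'.edges } = { e | e ∈ c.edges }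

/-- Data exhibiting `G` as the graph `H_T` obtained from the induced subgraph on `Hset`
by attaching, at each vertex of `T ⊆ Hset`, a union of complete graphs having that vertex as
their only common vertex: a family of cliques `C i` of `G`, each meeting `Hset` exactly in
its attachment vertex `a i ∈ T`, two distinct cliques meeting in at most the common
attachment vertex, together covering all vertices outside `Hset`, and all edges of `G`
lying either inside `Hset` or inside one of the cliques. -/
structure CliqueAttachment {V : Type} (G : SimpleGraph V) (Hset T : Set V) where
  ι : Type
  C : ι → Finset V
  a : ι → V
  a_mem_T : ∀ i, a i ∈ T
  T_sub : T ⊆ Hset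
  inter_H : ∀ i, (C i : Set V) ∩ Hset = {a i}
  a_mem_C : ∀ i, a i ∈ C i
  clique : ∀ i, G.IsClique (C i)
  pairwise_inter : ∀ i j, i ≠ j → (C i : Set V) ∩ (C j : Set V) ⊆ ({a i} : Set V)
  cover : Hset ∪ (⋃ i, (C i : Set V)) = Set.univ
  edges_sub : ∀ u v, G.Adj u v → (u ∈ Hset ∧ v ∈ Hset) ∨ ∃ i, u ∈ C i ∧ v ∈ C i

end EdgeIdealReg

namespace RegAux
open scoped Classical

section graded
variable {K σ : Type} [Field K]

/-- `p` is an admissible entry from a generator of degree `e` to one of degree `m`. -/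
def Gr (m e : ℕ) (p : MvPolynomial σ K) : Prop :=
  p = 0 ∨ ∃ t, e = m + t ∧ p.IsHomogeneous t

lemma Gr.zero (m e : ℕ) : Gr m e (0 : MvPolynomial σ K) := Or.inl rfl

lemma Gr.add {m e : ℕ} {p q : MvPolynomial σ K} (hp : Gr m e p) (hq : Gr m e q) :
    Gr m e (p + q) := by
  rcases hp with rfl | ⟨t, ht, hp⟩
  · simpa using hq
  rcases hq with rfl | ⟨s, hs, hq⟩
  · rw [add_zero]; exact Or.inr ⟨t, ht, hp⟩
  obtain rfl : s = t := by omega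
  exact Or.inr ⟨s, hs, hp.add hq⟩

lemma Gr.neg {m e : ℕ} {p : MvPolynomial σ K} (hp : Gr m e p) : Gr m e (-p) := by
  rcases hp with rfl | ⟨t, ht, hp⟩
  · simpa using Gr.zero m e
  · exact Or.inr ⟨t, ht, hp.neg⟩

lemma Gr.mul {a b c : ℕ} {p q : MvPolynomial σ K} (hp : Gr a b p) (hq : Gr b c q) :
    Gr a c (p * q) := by
  rcases hp with rfl | ⟨t, ht, hp⟩
  · simpa using Gr.zero a c
  rcases hq with rfl | ⟨s, hs, hq⟩
  · simpa using Gr.zero a c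
  exact Or.inr ⟨t + s, by omega, hp.mul hq⟩

lemma Gr.sum {α : Type} (s : Finset α) {m e : ℕ} {f : α → MvPolynomial σ K}
    (h : ∀ a ∈ s, Gr m e (f a)) : Gr m e (∑ a ∈ s, f a) := by
  induction s using Finset.induction_on with
  | empty => simpa using Gr.zero m e
  | insert a s ha ih =>
    rw [Finset.sum_insert ha]
    exact (h a (by simp)).add (ih fun b hb => h b (by simp [hb]))

lemma Gr.shift {a b : ℕ} {p : MvPolynomial σ K} (hp : Gr a b p) (s : ℕ) :
    Gr (a + s) (b + s) p := by
  rcases hp with rfl | ⟨t, ht, hp⟩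
  · exact Gr.zero _ _
  · exact Or.inr ⟨t, by omega, hp⟩

lemma Gr.of_homog {s : ℕ} {p : MvPolynomial σ K} (hp : p.IsHomogeneous s) (a : ℕ) :
    Gr a (a + s) p := Or.inr ⟨s, rfl, hp⟩

lemma Gr.one (a : ℕ) : Gr a a (1 : MvPolynomial σ K) := Or.inr ⟨0, rfl, isHomogeneous_one _ _⟩

/-- projection to degree `e` of a coordinate attached to a generator of degree `m` -/
def cmp (m e : ℕ) : MvPolynomial σ K →ₗ[K] MvPolynomial σ K :=
  if m ≤ e then homogeneousComponent (e - m) else 0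

lemma cmp_gr (m e : ℕ) (p : MvPolynomial σ K) : Gr m e (cmp m e p) := by
  unfold cmp
  split_ifs with h
  · exact Or.inr ⟨e - m, by omega, homogeneousComponent_isHomogeneous _ _⟩
  · exact Gr.zero _ _

lemma cmp_self {m e : ℕ} {p : MvPolynomial σ K} (h : Gr m e p) : cmp m e p = p := by
  rcases h with rfl | ⟨t, rfl, hp⟩
  · simp
  · simp only [cmp, Nat.le_add_right, if_true, Nat.add_sub_cancel_left]
    exact homogeneousComponent_eq_self hp

lemma cmp_eq_zero {m e n : ℕ} {p : MvPolynomial σ K} (h : Gr m n p) (hne : n ≠ e) :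
    cmp m e p = 0 := by
  rcases h with rfl | ⟨t, rfl, hp⟩
  · simp
  · unfold cmp
    split_ifs with h
    · rw [homogeneousComponent_of_mem (hp : p ∈ homogeneousSubmodule σ K t), if_neg (by omega)]
    · rfl

lemma cmp_mul {m n : ℕ} (e : ℕ) {p : MvPolynomial σ K} (hp : Gr m n p) (q : MvPolynomial σ K) :
    p * cmp n e q = cmp m e (p * q) := by
  rw [← sum_homogeneousComponent q, Finset.mul_sum, map_sum, map_sum, Finset.mul_sum]
  refine Finset.sum_congr rfl fun i _ => ?_
  have hq : Gr n (n + i) (homogeneousComponent i q) :=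
    Gr.of_homog (homogeneousComponent_isHomogeneous _ _) n
  by_cases h : n + i = e
  · subst h
    rw [cmp_self hq, cmp_self (hp.mul hq)]
  · rw [cmp_eq_zero hq h, cmp_eq_zero (hp.mul hq) h, mul_zero]

lemma Gr.constantCoeff {m e : ℕ} {p : MvPolynomial σ K} (h : Gr m e p) (hne : m < e) :
    MvPolynomial.constantCoeff p = 0 := by
  rcases h with rfl | ⟨t, rfl, hp⟩
  · simp
  · rw [constantCoeff_eq]
    exact hp.coeff_eq_zero (by simp; omega)

/-- matrices of graded maps -/
def GrM {a b : Type} (da : a → ℕ) (db : b → ℕ) (M : Matrix a b (MvPolynomial σ K)) : Prop :=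
  ∀ i j, Gr (da i) (db j) (M i j)

lemma GrM.mul {a b c : Type} [Fintype b] {da : a → ℕ} {db : b → ℕ} {dc : c → ℕ}
    {M : Matrix a b (MvPolynomial σ K)} {N : Matrix b c (MvPolynomial σ K)}
    (hM : GrM da db M) (hN : GrM db dc N) : GrM da dc (M * N) := fun i j => by
  rw [Matrix.mul_apply]
  exact Gr.sum _ fun k _ => (hM i k).mul (hN k j)

lemma exists_lift {R a b c : Type} [CommRing R] [Fintype b] {N : Matrix a b R}
    {P : Matrix a c R} (h : ∀ j, (fun i => P i j) ∈ LinearMap.range N.mulVecLin) :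
    ∃ Q : Matrix b c R, N * Q = P := by
  choose w hw using h
  refine ⟨Matrix.of fun i j => w j i, ?_⟩
  ext1 i j
  exact congrFun (hw j) i

lemma exists_lift_graded {a b c : Type} [Fintype b] {da : a → ℕ} {db : b → ℕ} {dc : c → ℕ}
    {N : Matrix a b (MvPolynomial σ K)} {P : Matrix a c (MvPolynomial σ K)}
    (hN : GrM da db N) (hP : GrM da dc P)
    (h : ∀ j, (fun i => P i j) ∈ LinearMap.range N.mulVecLin) :
    ∃ Q : Matrix b c (MvPolynomial σ K), GrM db dc Q ∧ N * Q = P := by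
  obtain ⟨Q, rfl⟩ := exists_lift h
  refine ⟨Matrix.of fun i j => cmp (db i) (dc j) (Q i j), fun i j => cmp_gr _ _ _, ?_⟩
  ext1 i j
  rw [← cmp_self (hP i j), Matrix.mul_apply, Matrix.mul_apply, map_sum]
  exact Finset.sum_congr rfl fun k _ => cmp_mul _ (hN i k) _

end graded

lemma exists_seq {α : ℕ → Type} (P : ∀ n, α n → Prop) (R : ∀ n, α n → α (n + 1) → Prop)
    (a0 : α 0) (h0 : P 0 a0) (step : ∀ n a, P n a → ∃ b, P (n + 1) b ∧ R n a b) :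
    ∃ f : ∀ n, α n, f 0 = a0 ∧ ∀ n, P n (f n) ∧ R n (f n) (f (n + 1)) := by
  choose s hs using step
  let g : ∀ n, {a : α n // P n a} := fun n =>
    Nat.rec (motive := fun n => {a : α n // P n a}) ⟨a0, h0⟩
      (fun n a => ⟨s n a.1 a.2, (hs n a.1 a.2).1⟩) n
  exact ⟨fun n => (g n).1, rfl, fun n => ⟨(g n).2, (hs n (g n).1 (g n).2).2⟩⟩

/-- A graded complex of finite free modules over a polynomial ring, with a single generator
(of degree `0`) in homological degree `0`. -/
structure GC (K σ : Type) [Field K] where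
  ι : ℕ → Type
  ft : ∀ n, Fintype (ι n)
  deg : ∀ n, ι n → ℕ
  z : ι 0
  hz : ∀ k, k = z
  deg_z : deg 0 z = 0
  mat : ∀ n, Matrix (ι n) (ι (n + 1)) (MvPolynomial σ K)
  homog : ∀ n, GrM (deg n) (deg (n + 1)) (mat n)
  sq : ∀ n, mat n * mat (n + 1) = 0

attribute [instance] GC.ft

variable {K σ : Type} [Field K]

/-- The complex is a resolution of `S/I`. -/
structure GC.Resolves (X : GC K σ) (I : Ideal (MvPolynomial σ K)) : Prop where
  range_zero : ∀ f : MvPolynomial σ K,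
    f ∈ I ↔ (fun _ => f) ∈ LinearMap.range (Matrix.mulVecLin (X.mat 0))
  exact : ∀ n v, (X.mat n).mulVec v = 0 → ∃ w, v = (X.mat (n + 1)).mulVec w

lemma comparison (X Y : GC K σ) {J I : Ideal (MvPolynomial σ K)} (hY : Y.Resolves I)
    (hX : ∀ j, X.mat 0 X.z j ∈ J) (hJI : J ≤ I) :
    ∃ φ : ∀ n, Matrix (Y.ι n) (X.ι n) (MvPolynomial σ K),
      (φ 0 = Matrix.of fun _ _ => 1) ∧ (∀ n, GrM (Y.deg n) (X.deg n) (φ n)) ∧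
      ∀ n, Y.mat n * φ (n + 1) = φ n * X.mat n := by
  have key := exists_seq (α := fun n => Matrix (Y.ι n) (X.ι n) (MvPolynomial σ K))
    (P := fun n a => GrM (Y.deg n) (X.deg n) a ∧
      ∀ j, (fun i => (a * X.mat n) i j) ∈ LinearMap.range (Y.mat n).mulVecLin)
    (R := fun n a b => Y.mat n * b = a * X.mat n) (Matrix.of fun _ _ => 1) ?_ ?_
  · obtain ⟨f, hf, h⟩ := key
    exact ⟨f, hf, fun n => (h n).1.1, fun n => (h n).2⟩
  · refine ⟨fun i j => ?_, fun j => ?_⟩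
    · rw [Y.hz i, X.hz j, Y.deg_z, X.deg_z]
      exact Gr.one 0
    · have : (fun i => ((Matrix.of fun _ _ => 1 : Matrix (Y.ι 0) (X.ι 0) (MvPolynomial σ K)) * X.mat 0) i j)
        = fun _ => X.mat 0 X.z j := by
        funext i
        rw [Matrix.mul_apply]
        have : (Finset.univ : Finset (X.ι 0)) = {X.z} := by
          ext k; simp [X.hz k]
        rw [this]; simp
      rw [this]
      exact (hY.range_zero _).1 (hJI (hX j))
  · rintro n a ⟨ha, hr⟩
    obtain ⟨b, hb, hab⟩ := exists_lift_graded (Y.homog n) (ha.mul (X.homog n)) hr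
    refine ⟨b, ⟨hb, fun j => ?_⟩, hab⟩
    obtain ⟨w, hw⟩ := hY.exact n (fun i => (b * X.mat (n + 1)) i j) (by
      have : Y.mat n * (b * X.mat (n + 1)) = 0 := by
        rw [← Matrix.mul_assoc, hab, Matrix.mul_assoc, X.sq, Matrix.mul_zero]
      funext i
      exact congrFun (congrFun this i) j)
    exact ⟨w, hw.symm⟩

end RegAux

namespace RegAux
open scoped Classical
variable {K σ : Type} [Field K]

lemma matrix_eq_zero_of_mulVec {R a b : Type} [CommRing R] [Fintype b] {M : Matrix a b R}
    (h : ∀ v, M.mulVec v = 0) : M = 0 := by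
  ext i j
  have := congrFun (h (Pi.single j 1)) i
  simpa using this

section cone
variable (A B : GC K σ) (f : MvPolynomial σ K)
  (φ : ∀ n, Matrix (A.ι n) (B.ι n) (MvPolynomial σ K))

/-- index types of the cone -/
def coneι : ℕ → Type
  | 0 => B.ι 0
  | n + 1 => A.ι (n + 1) ⊕ (B.ι (n + 1) ⊕ {_b : B.ι n // 0 < n})

@[reducible]
def coneFt : ∀ n, Fintype (coneι A B n)
  | 0 => B.ft 0
  | n + 1 => inferInstanceAs (Fintype (A.ι (n + 1) ⊕ (B.ι (n + 1) ⊕ {_b : B.ι n // 0 < n})))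

def coneDeg : ∀ n, coneι A B n → ℕ
  | 0 => B.deg 0
  | n + 1 => Sum.elim (fun a => A.deg (n + 1) a + 1)
      (Sum.elim (fun b => B.deg (n + 1) b) (fun b => B.deg n b.1 + 1))

def coneMat0 : Matrix (B.ι 0) (A.ι 1 ⊕ (B.ι 1 ⊕ {_b : B.ι 0 // 0 < 0})) (MvPolynomial σ K) :=
  Matrix.of fun i => Sum.elim (fun a => A.mat 0 A.z a * f)
    (Sum.elim (fun b => B.mat 0 i b) (fun _ => 0))

def coneMatS (n : ℕ) : Matrix (A.ι (n + 1) ⊕ (B.ι (n + 1) ⊕ {_b : B.ι n // 0 < n}))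
    (A.ι (n + 2) ⊕ (B.ι (n + 2) ⊕ {_b : B.ι (n + 1) // 0 < n + 1})) (MvPolynomial σ K) :=
  Matrix.of fun i j => match i, j with
    | Sum.inl i, Sum.inl j => A.mat (n + 1) i j
    | Sum.inl _, Sum.inr (Sum.inl _) => 0
    | Sum.inl i, Sum.inr (Sum.inr j) => φ (n + 1) i j.1
    | Sum.inr _, Sum.inl _ => 0
    | Sum.inr (Sum.inl i), Sum.inr (Sum.inl j) => B.mat (n + 1) i j
    | Sum.inr (Sum.inl i), Sum.inr (Sum.inr j) => if i = j.1 then - f else 0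
    | Sum.inr (Sum.inr _), Sum.inr (Sum.inl _) => 0
    | Sum.inr (Sum.inr i), Sum.inr (Sum.inr j) => - B.mat n i.1 j.1

def coneMat : ∀ n, Matrix (coneι A B n) (coneι A B (n + 1)) (MvPolynomial σ K)
  | 0 => coneMat0 A B f
  | n + 1 => coneMatS A B f φ n

/-- identification of vectors indexed by the trivial subtype -/
def ext' {α : Type} {n : ℕ} (b : {_b : α // 0 < n + 1} → MvPolynomial σ K) : α → MvPolynomial σ K :=
  fun i => b ⟨i, Nat.succ_pos n⟩

lemma sum_ext' {α : Type} [Fintype α] {n : ℕ} (g : α → MvPolynomial σ K)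
    (b : {_b : α // 0 < n + 1} → MvPolynomial σ K) :
    ∑ j, g j.1 * b j = ∑ j, g j * ext' b j :=
  Fintype.sum_equiv (Equiv.subtypeUnivEquiv fun _ => Nat.succ_pos n) _ _ fun _ => rfl

lemma coneMat0_mulVec (v : A.ι 1 ⊕ (B.ι 1 ⊕ {_b : B.ι 0 // 0 < 0}) → MvPolynomial σ K)
    (i : B.ι 0) :
    (coneMat0 A B f).mulVec v i = f * (A.mat 0).mulVec (fun j => v (Sum.inl j)) A.z +
      (B.mat 0).mulVec (fun j => v (Sum.inr (Sum.inl j))) i := by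
  simp only [Matrix.mulVec, dotProduct, Fintype.sum_sum_type, coneMat0, Matrix.of_apply,
    Sum.elim_inl, Sum.elim_inr, zero_mul, Finset.sum_const_zero, add_zero, Finset.mul_sum]
  congr 1
  exact Finset.sum_congr rfl fun _ _ => by ring

section
variable (n : ℕ) (v : A.ι (n + 2) ⊕ (B.ι (n + 2) ⊕ {_b : B.ι (n + 1) // 0 < n + 1}) →
    MvPolynomial σ K)

lemma coneMatS_mulVec_a (i : A.ι (n + 1)) :
    (coneMatS A B f φ n).mulVec v (Sum.inl i) =
      (A.mat (n + 1)).mulVec (fun j => v (Sum.inl j)) i +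
      (φ (n + 1)).mulVec (ext' fun j => v (Sum.inr (Sum.inr j))) i := by
  simp only [Matrix.mulVec, dotProduct, Fintype.sum_sum_type, coneMatS, Matrix.of_apply,
    zero_mul, Finset.sum_const_zero, zero_add]
  rw [← sum_ext']

lemma coneMatS_mulVec_b (i : B.ι (n + 1)) :
    (coneMatS A B f φ n).mulVec v (Sum.inr (Sum.inl i)) =
      (B.mat (n + 1)).mulVec (fun j => v (Sum.inr (Sum.inl j))) i -
      f * (ext' fun j => v (Sum.inr (Sum.inr j))) i := by
  simp only [Matrix.mulVec, dotProduct, Fintype.sum_sum_type, coneMatS, Matrix.of_apply,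
    zero_mul, Finset.sum_const_zero, zero_add]
  rw [sum_ext' (fun j => if i = j then - f else 0)]
  simp [sub_eq_add_neg]

lemma coneMatS_mulVec_c (i : {_b : B.ι n // 0 < n}) :
    (coneMatS A B f φ n).mulVec v (Sum.inr (Sum.inr i)) =
      - (B.mat n).mulVec (ext' fun j => v (Sum.inr (Sum.inr j))) i.1 := by
  simp only [Matrix.mulVec, dotProduct, Fintype.sum_sum_type, coneMatS, Matrix.of_apply,
    zero_mul, Finset.sum_const_zero, zero_add]
  rw [sum_ext' (fun j => - B.mat n i.1 j)]
  simp
end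

variable {A B f φ}

lemma mulVec_zero_apply {X : GC K σ} {n : ℕ} (v : X.ι (n + 2) → MvPolynomial σ K) :
    (X.mat n).mulVec ((X.mat (n + 1)).mulVec v) = 0 := by
  rw [Matrix.mulVec_mulVec, X.sq, Matrix.zero_mulVec]

lemma phi_zero (h0 : φ 0 = Matrix.of fun _ _ => 1)
    (hφ : ∀ n, A.mat n * φ (n + 1) = φ n * B.mat n) (w : B.ι 1 → MvPolynomial σ K) (i : A.ι 0)
    (j : B.ι 0) :
    (A.mat 0).mulVec ((φ 1).mulVec w) i = (B.mat 0).mulVec w j := by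
  rw [Matrix.mulVec_mulVec, hφ 0, ← Matrix.mulVec_mulVec, h0]
  have : (Finset.univ : Finset (B.ι 0)) = {j} := by
    ext k; simp [B.hz k, B.hz j]
  simp [Matrix.mulVec, dotProduct, this]

lemma coneSq (h0 : φ 0 = Matrix.of fun _ _ => 1)
    (hφ : ∀ n, A.mat n * φ (n + 1) = φ n * B.mat n) (n : ℕ) :
    let _ := coneFt A B
    coneMat A B f φ n * coneMat A B f φ (n + 1) = 0 := by
  let _ := coneFt A B
  apply matrix_eq_zero_of_mulVec
  intro v
  rw [← Matrix.mulVec_mulVec]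
  cases n with
  | zero =>
    funext i
    refine (coneMat0_mulVec A B f _ i).trans ?_
    have e1 : (fun j => (coneMat A B f φ (0 + 1)).mulVec v (Sum.inl j)) =
        (A.mat 1).mulVec (fun j => v (Sum.inl j)) +
        (φ 1).mulVec (ext' fun j => v (Sum.inr (Sum.inr j))) :=
      funext fun j => coneMatS_mulVec_a A B f φ 0 v j
    have e2 : (fun j => (coneMat A B f φ (0 + 1)).mulVec v (Sum.inr (Sum.inl j))) =
        (B.mat 1).mulVec (fun j => v (Sum.inr (Sum.inl j))) -
        f • (ext' fun j => v (Sum.inr (Sum.inr j))) :=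
      funext fun j => coneMatS_mulVec_b A B f φ 0 v j
    rw [e1, e2, Matrix.mulVec_add, Matrix.mulVec_sub, mulVec_zero_apply, mulVec_zero_apply,
      Matrix.mulVec_smul]
    rw [zero_add, zero_sub, phi_zero h0 hφ _ A.z i]
    exact add_neg_cancel _
  | succ n =>
    have e1 : (fun j => (coneMat A B f φ (n + 1 + 1)).mulVec v (Sum.inl j)) =
        (A.mat (n + 2)).mulVec (fun j => v (Sum.inl j)) +
        (φ (n + 2)).mulVec (ext' fun j => v (Sum.inr (Sum.inr j))) :=
      funext fun j => coneMatS_mulVec_a A B f φ (n + 1) v j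
    have e2 : (fun j => (coneMat A B f φ (n + 1 + 1)).mulVec v (Sum.inr (Sum.inl j))) =
        (B.mat (n + 2)).mulVec (fun j => v (Sum.inr (Sum.inl j))) -
        f • (ext' fun j => v (Sum.inr (Sum.inr j))) :=
      funext fun j => coneMatS_mulVec_b A B f φ (n + 1) v j
    have e3 : (ext' fun j => (coneMat A B f φ (n + 1 + 1)).mulVec v (Sum.inr (Sum.inr j))) =
        - (B.mat (n + 1)).mulVec (ext' fun j => v (Sum.inr (Sum.inr j))) :=
      funext fun j => coneMatS_mulVec_c A B f φ (n + 1) v ⟨j, Nat.succ_pos n⟩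
    funext i
    rcases i with i | i | i
    · refine (coneMatS_mulVec_a A B f φ n _ i).trans ?_
      rw [e1, e3, Matrix.mulVec_add, mulVec_zero_apply, Matrix.mulVec_neg, Matrix.mulVec_mulVec,
        Matrix.mulVec_mulVec, hφ (n + 1)]
      simp only [zero_add, Pi.neg_apply]
      exact add_neg_cancel _
    · refine (coneMatS_mulVec_b A B f φ n _ i).trans ?_
      rw [e2, e3, Matrix.mulVec_sub, mulVec_zero_apply, Matrix.mulVec_smul]
      simp only [zero_sub, Pi.neg_apply, Pi.smul_apply, smul_eq_mul, mul_neg, sub_neg_eq_add,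
        neg_add_cancel]
      rfl
    · refine (coneMatS_mulVec_c A B f φ n _ i).trans ?_
      rw [e3, Matrix.mulVec_neg, mulVec_zero_apply, neg_zero]
      exact neg_zero

lemma coneHomog (hf : f.IsHomogeneous 1)
    (hg : ∀ n, GrM (A.deg n) (B.deg n) (φ n)) (n : ℕ) :
    GrM (coneDeg A B n) (coneDeg A B (n + 1)) (coneMat A B f φ n) := by
  cases n with
  | zero =>
    intro i j
    rcases j with j | j | j
    · have : Gr 0 (A.deg 1 j + 1) (A.mat 0 A.z j * f) :=
        (A.deg_z ▸ A.homog 0 A.z j).mul (Gr.of_homog hf _)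
      have e : coneDeg A B 0 i = 0 := by
        show B.deg 0 i = 0
        rw [B.hz i, B.deg_z]
      rw [e]
      exact this
    · exact B.homog 0 i j
    · exact Gr.zero _ _
  | succ n =>
    intro i j
    rcases i with i | i | i <;> rcases j with j | j | j
    · exact (A.homog (n + 1) i j).shift 1
    · exact Gr.zero _ _
    · exact (hg (n + 1) i j.1).shift 1
    · exact Gr.zero _ _
    · exact B.homog (n + 1) i j
    · show Gr (B.deg (n + 1) i) (B.deg (n + 1) j.1 + 1) (if i = j.1 then - f else 0)
      split_ifs with h
      · rw [h]; exact (Gr.of_homog hf _).neg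
      · exact Gr.zero _ _
    · exact Gr.zero _ _
    · exact Gr.zero _ _
    · exact ((B.homog n i.1 j.1).shift 1).neg

/-- The mapping cone. -/
def cone (hf : f.IsHomogeneous 1) (hg : ∀ n, GrM (A.deg n) (B.deg n) (φ n))
    (h0 : φ 0 = Matrix.of fun _ _ => 1)
    (hφ : ∀ n, A.mat n * φ (n + 1) = φ n * B.mat n) : GC K σ where
  ι := coneι A B
  ft := coneFt A B
  deg := coneDeg A B
  z := B.z
  hz := B.hz
  deg_z := B.deg_z
  mat := coneMat A B f φ
  homog := coneHomog hf hg
  sq := coneSq h0 hφ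

lemma cone_exact0 (h0 : φ 0 = Matrix.of fun _ _ => 1)
    (hφ : ∀ n, A.mat n * φ (n + 1) = φ n * B.mat n) {J Q : Ideal (MvPolynomial σ K)}
    (hA : A.Resolves Q) (hB : B.Resolves J) (hreg : ∀ p, f * p ∈ J → p ∈ J)
    (v : A.ι 1 ⊕ (B.ι 1 ⊕ {_b : B.ι 0 // 0 < 0}) → MvPolynomial σ K)
    (hv : (coneMat0 A B f).mulVec v = 0) : ∃ w, v = (coneMatS A B f φ 0).mulVec w := by
  have mkB : ∀ (b : B.ι 1 → MvPolynomial σ K), (B.mat 0).mulVec b B.z ∈ J := fun a =>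
    (hB.range_zero _).2 ⟨a, funext fun i => by rw [B.hz i]; rfl⟩
  have h1 := (coneMat0_mulVec A B f v B.z).symm.trans (congrFun hv B.z)
  obtain ⟨a, ha⟩ : ∃ a : A.ι 1 → MvPolynomial σ K, a = fun j => v (Sum.inl j) := ⟨_, rfl⟩
  obtain ⟨b, hb⟩ : ∃ b : B.ι 1 → MvPolynomial σ K, b = fun j => v (Sum.inr (Sum.inl j)) :=
    ⟨_, rfl⟩
  rw [← ha, ← hb, Pi.zero_apply] at h1
  have h2 : (A.mat 0).mulVec a A.z ∈ J := hreg _ (by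
    rw [eq_neg_of_add_eq_zero_left h1]
    exact J.neg_mem (mkB b))
  obtain ⟨b', hb'⟩ := (hB.range_zero _).1 h2
  have hb'z := congrFun hb' B.z
  simp only [Matrix.mulVecLin_apply] at hb'z
  obtain ⟨a2, ha2⟩ := hA.exact 0 (a - (φ 1).mulVec b') (by
    funext i
    rw [Matrix.mulVec_sub, Pi.sub_apply, phi_zero h0 hφ b' i B.z, hb'z, A.hz i]
    exact sub_self _)
  obtain ⟨b2, hb2⟩ := hB.exact 0 (b + f • b') (by
    funext i
    rw [Matrix.mulVec_add, Matrix.mulVec_smul, Pi.add_apply, Pi.smul_apply, B.hz i, hb'z,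
      add_comm]
    exact h1)
  refine ⟨Sum.elim a2 (Sum.elim b2 fun j => b' j.1), funext fun i => ?_⟩
  rcases i with i | i | i
  · refine Eq.trans ?_ (coneMatS_mulVec_a A B f φ 0 _ i).symm
    refine (congrFun ha i).symm.trans ?_
    exact sub_eq_iff_eq_add.1 (congrFun ha2 i)
  · refine Eq.trans ?_ (coneMatS_mulVec_b A B f φ 0 _ i).symm
    refine (congrFun hb i).symm.trans ?_
    exact eq_sub_iff_add_eq.2 (congrFun hb2 i)
  · exact absurd i.2 (lt_irrefl 0)

lemma cone_exactS (hφ : ∀ n, A.mat n * φ (n + 1) = φ n * B.mat n) {J Q : Ideal (MvPolynomial σ K)}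
    (hA : A.Resolves Q) (hB : B.Resolves J) (hfne : f ≠ 0) (n : ℕ)
    (v : A.ι (n + 2) ⊕ (B.ι (n + 2) ⊕ {_b : B.ι (n + 1) // 0 < n + 1}) → MvPolynomial σ K)
    (hv : (coneMatS A B f φ n).mulVec v = 0) :
    ∃ w, v = (coneMatS A B f φ (n + 1)).mulVec w := by
  obtain ⟨a, ha⟩ : ∃ a : A.ι (n + 2) → MvPolynomial σ K, a = fun j => v (Sum.inl j) := ⟨_, rfl⟩
  obtain ⟨b, hb⟩ : ∃ b : B.ι (n + 2) → MvPolynomial σ K, b = fun j => v (Sum.inr (Sum.inl j)) :=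
    ⟨_, rfl⟩
  obtain ⟨c, hc⟩ : ∃ c : B.ι (n + 1) → MvPolynomial σ K,
    c = ext' fun j => v (Sum.inr (Sum.inr j)) := ⟨_, rfl⟩
  have h1 : (A.mat (n + 1)).mulVec a + (φ (n + 1)).mulVec c = 0 := funext fun i => by
    have := (coneMatS_mulVec_a A B f φ n v i).symm.trans (congrFun hv (Sum.inl i))
    rw [← ha, ← hc] at this
    exact this
  have h2 : (B.mat (n + 1)).mulVec b - f • c = 0 := funext fun i => by
    have := (coneMatS_mulVec_b A B f φ n v i).symm.trans (congrFun hv (Sum.inr (Sum.inl i)))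
    rw [← hb, ← hc] at this
    exact this
  have h3 : (B.mat n).mulVec c = 0 := by
    have h4 : f • (B.mat n).mulVec c = 0 := by
      rw [← Matrix.mulVec_smul, ← sub_eq_zero.1 h2, mulVec_zero_apply]
    funext i
    exact (mul_eq_zero.1 (congrFun h4 i)).resolve_left hfne
  obtain ⟨c', hc'⟩ := hB.exact n c h3
  obtain ⟨b2, hb2⟩ := hB.exact (n + 1) (b - f • c') (by
    rw [Matrix.mulVec_sub, Matrix.mulVec_smul, ← hc', h2])
  obtain ⟨a2, ha2⟩ := hA.exact (n + 1) (a + (φ (n + 2)).mulVec c') (by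
    rw [Matrix.mulVec_add, Matrix.mulVec_mulVec, hφ (n + 1), ← Matrix.mulVec_mulVec, ← hc', h1])
  refine ⟨Sum.elim a2 (Sum.elim b2 fun j => - c' j.1), funext fun i => ?_⟩
  have hext' : ext' (fun j : {_b : B.ι (n + 2) // 0 < n + 1 + 1} =>
    (Sum.elim a2 (Sum.elim b2 fun j : {_b : B.ι (n + 2) // 0 < n + 1 + 1} => - c' j.1))
      (Sum.inr (Sum.inr j))) = - c' := rfl
  rcases i with i | i | i
  · refine Eq.trans ?_ (coneMatS_mulVec_a A B f φ (n + 1) _ i).symm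
    rw [hext', Matrix.mulVec_neg]
    refine (congrFun ha i).symm.trans ?_
    exact eq_add_neg_iff_add_eq.2 (congrFun ha2 i)
  · refine Eq.trans ?_ (coneMatS_mulVec_b A B f φ (n + 1) _ i).symm
    rw [hext', Pi.neg_apply, mul_neg, sub_neg_eq_add]
    refine (congrFun hb i).symm.trans ?_
    exact sub_eq_iff_eq_add.1 (congrFun hb2 i)
  · refine Eq.trans ?_ (coneMatS_mulVec_c A B f φ (n + 1) _ i).symm
    rw [hext', Matrix.mulVec_neg, Pi.neg_apply, neg_neg]
    refine Eq.trans ?_ (congrFun hc' i.1)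
    exact (congrFun hc i.1).symm

lemma cone_resolves (hf : f.IsHomogeneous 1) (hg : ∀ n, GrM (A.deg n) (B.deg n) (φ n))
    (h0 : φ 0 = Matrix.of fun _ _ => 1)
    (hφ : ∀ n, A.mat n * φ (n + 1) = φ n * B.mat n) {I J Q : Ideal (MvPolynomial σ K)}
    (hA : A.Resolves Q) (hB : B.Resolves J) (hreg : ∀ p, f * p ∈ J → p ∈ J) (hfne : f ≠ 0)
    (hI : ∀ p, p ∈ I ↔ ∃ q ∈ Q, ∃ j ∈ J, p = f * q + j) :
    (cone hf hg h0 hφ).Resolves I := by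
  have mkA : ∀ (a : A.ι 1 → MvPolynomial σ K), (A.mat 0).mulVec a A.z ∈ Q := fun a =>
    (hA.range_zero _).2 ⟨a, funext fun i => by rw [A.hz i]; rfl⟩
  have mkB : ∀ (b : B.ι 1 → MvPolynomial σ K), (B.mat 0).mulVec b B.z ∈ J := fun a =>
    (hB.range_zero _).2 ⟨a, funext fun i => by rw [B.hz i]; rfl⟩
  constructor
  · intro p
    constructor
    · intro hp
      obtain ⟨q, hq, j, hj, rfl⟩ := (hI _).1 hp
      obtain ⟨a, ha⟩ := (hA.range_zero _).1 hq
      obtain ⟨b, hb⟩ := (hB.range_zero _).1 hj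
      refine ⟨Sum.elim a (Sum.elim b (fun _ => 0)), funext fun i => ?_⟩
      refine (coneMat0_mulVec A B f _ i).trans ?_
      have ha' := congrFun ha A.z
      have hb' := congrFun hb i
      simp only [Matrix.mulVecLin_apply] at ha' hb'
      simp only [Sum.elim_inl, Sum.elim_inr]
      rw [← ha', ← hb']
    · rintro ⟨v, hv⟩
      have := (congrFun hv B.z).symm.trans (coneMat0_mulVec A B f v B.z)
      exact (hI _).2 ⟨_, mkA _, _, mkB _, this⟩
  · intro n v hv
    cases n with
    | zero => exact cone_exact0 h0 hφ hA hB hreg v hv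
    | succ n => exact cone_exactS hφ hA hB hfne n v hv

end cone

end RegAux

namespace RegAux
open scoped Classical
variable {K σ : Type} [Field K]

section kos
variable (B : GC K σ) (f : MvPolynomial σ K) (s : ℕ)

/-- index types of the Koszul cone -/
def kι : ℕ → Type
  | 0 => B.ι 0
  | n + 1 => B.ι (n + 1) ⊕ B.ι n

@[reducible]
def kFt : ∀ n, Fintype (kι B n)
  | 0 => B.ft 0
  | n + 1 => inferInstanceAs (Fintype (B.ι (n + 1) ⊕ B.ι n))

def kDeg : ∀ n, kι B n → ℕ
  | 0 => B.deg 0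
  | n + 1 => Sum.elim (B.deg (n + 1)) (fun b => B.deg n b + s)

def kMat0 : Matrix (B.ι 0) (B.ι 1 ⊕ B.ι 0) (MvPolynomial σ K) :=
  Matrix.of fun i => Sum.elim (B.mat 0 i) (fun _ => f)

def kMatS (n : ℕ) : Matrix (B.ι (n + 1) ⊕ B.ι n) (B.ι (n + 2) ⊕ B.ι (n + 1))
    (MvPolynomial σ K) :=
  Matrix.of fun i j => match i, j with
    | Sum.inl i, Sum.inl j => B.mat (n + 1) i j
    | Sum.inl i, Sum.inr j => if i = j then f else 0
    | Sum.inr _, Sum.inl _ => 0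
    | Sum.inr i, Sum.inr j => - B.mat n i j

def kMat : ∀ n, Matrix (kι B n) (kι B (n + 1)) (MvPolynomial σ K)
  | 0 => kMat0 B f
  | n + 1 => kMatS B f n

lemma kMat0_mulVec (v : B.ι 1 ⊕ B.ι 0 → MvPolynomial σ K) (i : B.ι 0) :
    (kMat0 B f).mulVec v i = (B.mat 0).mulVec (fun j => v (Sum.inl j)) i +
      f * v (Sum.inr i) := by
  have : (Finset.univ : Finset (B.ι 0)) = {i} := by
    ext k; simp [B.hz k, B.hz i]
  simp [Matrix.mulVec, dotProduct, kMat0, this]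

section
variable (n : ℕ) (v : B.ι (n + 2) ⊕ B.ι (n + 1) → MvPolynomial σ K)

lemma kMatS_mulVec_b (i : B.ι (n + 1)) :
    (kMatS B f n).mulVec v (Sum.inl i) =
      (B.mat (n + 1)).mulVec (fun j => v (Sum.inl j)) i + f * v (Sum.inr i) := by
  simp [Matrix.mulVec, dotProduct, kMatS]

lemma kMatS_mulVec_c (i : B.ι n) :
    (kMatS B f n).mulVec v (Sum.inr i) =
      - (B.mat n).mulVec (fun j => v (Sum.inr j)) i := by
  simp [Matrix.mulVec, dotProduct, kMatS]
end

variable {B f s}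

lemma kSq (n : ℕ) :
    let _ := kFt B
    kMat B f n * kMat B f (n + 1) = 0 := by
  let _ := kFt B
  apply matrix_eq_zero_of_mulVec
  intro v
  rw [← Matrix.mulVec_mulVec]
  cases n with
  | zero =>
    have e1 : (fun j => (kMat B f (0 + 1)).mulVec v (Sum.inl j)) =
        (B.mat 1).mulVec (fun j => v (Sum.inl j)) + f • (fun j => v (Sum.inr j)) :=
      funext fun j => kMatS_mulVec_b B f 0 v j
    funext i
    have e2 : (kMat B f (0 + 1)).mulVec v (Sum.inr i) =
        - (B.mat 0).mulVec (fun j => v (Sum.inr j)) i := kMatS_mulVec_c B f 0 v i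
    refine (kMat0_mulVec B f _ i).trans ?_
    rw [e1, e2, Matrix.mulVec_add, mulVec_zero_apply, Matrix.mulVec_smul, zero_add, mul_neg]
    exact add_neg_cancel _
  | succ n =>
    have e1 : (fun j => (kMat B f (n + 1 + 1)).mulVec v (Sum.inl j)) =
        (B.mat (n + 2)).mulVec (fun j => v (Sum.inl j)) + f • (fun j => v (Sum.inr j)) :=
      funext fun j => kMatS_mulVec_b B f (n + 1) v j
    have e2 : (fun j => (kMat B f (n + 1 + 1)).mulVec v (Sum.inr j)) =
        - (B.mat (n + 1)).mulVec (fun j => v (Sum.inr j)) :=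
      funext fun j => kMatS_mulVec_c B f (n + 1) v j
    funext i
    rcases i with i | i
    · refine (kMatS_mulVec_b B f n _ i).trans ?_
      rw [e1, Matrix.mulVec_add, mulVec_zero_apply, Matrix.mulVec_smul, zero_add]
      have := congrFun e2 i
      rw [show (kMat B f (n + 1 + 1)).mulVec v (Sum.inr i) = _ from this, Pi.neg_apply, mul_neg]
      exact add_neg_cancel _
    · refine (kMatS_mulVec_c B f n _ i).trans ?_
      rw [e2, Matrix.mulVec_neg, mulVec_zero_apply, neg_zero]
      exact neg_zero

lemma kHomog (hf : f.IsHomogeneous s) (n : ℕ) :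
    GrM (kDeg B s n) (kDeg B s (n + 1)) (kMat B f n) := by
  cases n with
  | zero =>
    intro i j
    rcases j with j | j
    · exact B.homog 0 i j
    · show Gr (B.deg 0 i) (B.deg 0 j + s) f
      rw [B.hz i, B.hz j]
      exact Gr.of_homog hf _
  | succ n =>
    intro i j
    rcases i with i | i <;> rcases j with j | j
    · exact B.homog (n + 1) i j
    · show Gr (B.deg (n + 1) i) (B.deg (n + 1) j + s) (if i = j then f else 0)
      split_ifs with h
      · rw [h]; exact Gr.of_homog hf _
      · exact Gr.zero _ _
    · exact Gr.zero _ _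
    · exact ((B.homog n i j).shift s).neg

/-- The Koszul cone. -/
def kos (B : GC K σ) (hf : f.IsHomogeneous s) : GC K σ where
  ι := kι B
  ft := kFt B
  deg := kDeg B s
  z := B.z
  hz := B.hz
  deg_z := B.deg_z
  mat := kMat B f
  homog := kHomog hf
  sq := kSq

lemma kos_exact0 {J : Ideal (MvPolynomial σ K)}
    (hB : B.Resolves J) (hreg : ∀ p, f * p ∈ J → p ∈ J)
    (v : B.ι 1 ⊕ B.ι 0 → MvPolynomial σ K)
    (hv : (kMat0 B f).mulVec v = 0) : ∃ w, v = (kMatS B f 0).mulVec w := by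
  have mkB : ∀ (b : B.ι 1 → MvPolynomial σ K), (B.mat 0).mulVec b B.z ∈ J := fun a =>
    (hB.range_zero _).2 ⟨a, funext fun i => by rw [B.hz i]; rfl⟩
  have h1 := (kMat0_mulVec B f v B.z).symm.trans (congrFun hv B.z)
  obtain ⟨b, hb⟩ : ∃ b : B.ι 1 → MvPolynomial σ K, b = fun j => v (Sum.inl j) := ⟨_, rfl⟩
  rw [← hb, Pi.zero_apply] at h1
  have h2 : v (Sum.inr B.z) ∈ J := hreg _ (by
    rw [eq_neg_of_add_eq_zero_right h1]
    exact J.neg_mem (mkB b))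
  obtain ⟨b', hb'⟩ := (hB.range_zero _).1 h2
  have hb'z := congrFun hb' B.z
  simp only [Matrix.mulVecLin_apply] at hb'z
  obtain ⟨b2, hb2⟩ := hB.exact 0 (b + f • b') (by
    funext i
    rw [Matrix.mulVec_add, Matrix.mulVec_smul, Pi.add_apply, Pi.smul_apply, B.hz i, hb'z]
    exact h1)
  refine ⟨Sum.elim b2 (- b'), funext fun i => ?_⟩
  rcases i with i | i
  · refine Eq.trans ?_ (kMatS_mulVec_b B f 0 _ i).symm
    refine (congrFun hb i).symm.trans ?_
    simp only [Sum.elim_inr, Pi.neg_apply, mul_neg]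
    exact eq_add_neg_iff_add_eq.2 (congrFun hb2 i)
  · refine Eq.trans ?_ (kMatS_mulVec_c B f 0 _ i).symm
    have : (fun j => (Sum.elim b2 (-b')) (Sum.inr j)) = - b' := rfl
    rw [this, Matrix.mulVec_neg, Pi.neg_apply, neg_neg, B.hz i, hb'z]

lemma kos_exactS {J : Ideal (MvPolynomial σ K)} (hB : B.Resolves J) (n : ℕ)
    (v : B.ι (n + 2) ⊕ B.ι (n + 1) → MvPolynomial σ K)
    (hv : (kMatS B f n).mulVec v = 0) : ∃ w, v = (kMatS B f (n + 1)).mulVec w := by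
  obtain ⟨b, hb⟩ : ∃ b : B.ι (n + 2) → MvPolynomial σ K, b = fun j => v (Sum.inl j) := ⟨_, rfl⟩
  obtain ⟨c, hc⟩ : ∃ c : B.ι (n + 1) → MvPolynomial σ K, c = fun j => v (Sum.inr j) := ⟨_, rfl⟩
  have h1 : (B.mat (n + 1)).mulVec b + f • c = 0 := funext fun i => by
    have := (kMatS_mulVec_b B f n v i).symm.trans (congrFun hv (Sum.inl i))
    rw [← hb] at this
    rw [hc]
    exact this
  have h2 : (B.mat n).mulVec c = 0 := funext fun i => by
    have := (kMatS_mulVec_c B f n v i).symm.trans (congrFun hv (Sum.inr i))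
    rw [← hc] at this
    exact neg_eq_zero.1 this
  obtain ⟨c', hc'⟩ := hB.exact n c h2
  obtain ⟨b2, hb2⟩ := hB.exact (n + 1) (b + f • c') (by
    rw [Matrix.mulVec_add, Matrix.mulVec_smul, ← hc', h1])
  refine ⟨Sum.elim b2 (- c'), funext fun i => ?_⟩
  rcases i with i | i
  · refine Eq.trans ?_ (kMatS_mulVec_b B f (n + 1) _ i).symm
    refine (congrFun hb i).symm.trans ?_
    simp only [Sum.elim_inr, Pi.neg_apply, mul_neg]
    exact eq_add_neg_iff_add_eq.2 (congrFun hb2 i)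
  · refine Eq.trans ?_ (kMatS_mulVec_c B f (n + 1) _ i).symm
    have : (fun j => (Sum.elim b2 (-c')) (Sum.inr j)) = - c' := rfl
    rw [this, Matrix.mulVec_neg, Pi.neg_apply, neg_neg]
    refine Eq.trans ?_ (congrFun hc' i)
    exact (congrFun hc i).symm

lemma kos_resolves (hf : f.IsHomogeneous s) {I J : Ideal (MvPolynomial σ K)}
    (hB : B.Resolves J) (hreg : ∀ p, f * p ∈ J → p ∈ J)
    (hI : ∀ p, p ∈ I ↔ ∃ q, ∃ j ∈ J, p = f * q + j) :
    (kos B hf).Resolves I := by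
  have mkB : ∀ (b : B.ι 1 → MvPolynomial σ K), (B.mat 0).mulVec b B.z ∈ J := fun a =>
    (hB.range_zero _).2 ⟨a, funext fun i => by rw [B.hz i]; rfl⟩
  constructor
  · intro p
    constructor
    · intro hp
      obtain ⟨q, j, hj, rfl⟩ := (hI _).1 hp
      obtain ⟨b, hb⟩ := (hB.range_zero _).1 hj
      refine ⟨Sum.elim b (fun _ => q), funext fun i => ?_⟩
      refine (kMat0_mulVec B f _ i).trans ?_
      have hb' := congrFun hb i
      simp only [Matrix.mulVecLin_apply] at hb'
      simp only [Sum.elim_inl, Sum.elim_inr]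
      rw [← hb', add_comm]
      rfl
    · rintro ⟨v, hv⟩
      have := (congrFun hv B.z).symm.trans (kMat0_mulVec B f v B.z)
      exact (hI _).2 ⟨_, _, mkB _, this.trans (add_comm _ _)⟩
  · intro n v hv
    cases n with
    | zero => exact kos_exact0 hB hreg v hv
    | succ n => exact kos_exactS hB n v hv

end kos

/-- The trivial resolution of `S/0`. -/
def triv (K σ : Type) [Field K] : GC K σ where
  ι n := {_u : Unit // n = 0}
  ft n := inferInstance
  deg _ _ := 0
  z := ⟨(), rfl⟩
  hz _ := rfl
  deg_z := rfl
  mat _ := 0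
  homog _ _ _ := Gr.zero _ _
  sq _ := by simp

lemma triv_resolves : (triv K σ).Resolves ⊥ := by
  constructor
  · intro f
    constructor
    · intro h
      rw [Ideal.mem_bot] at h
      subst h
      exact ⟨0, by simp; rfl⟩
    · rintro ⟨v, hv⟩
      have h1 := congrFun hv (triv K σ).z
      have h2 : (triv K σ).mat 0 = 0 := rfl
      rw [h2, Matrix.mulVecLin_apply, Matrix.zero_mulVec] at h1
      exact h1.symm
  · intro n v _
    exact ⟨0, funext fun i => absurd i.2 (Nat.succ_ne_zero n)⟩

/-- `S/I` has a graded free resolution with generators in degrees `≤ d + i`. -/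
def Res (I : Ideal (MvPolynomial σ K)) (d : ℕ) : Prop :=
  ∃ X : GC K σ, X.Resolves I ∧ ∀ n k, X.deg n k ≤ d + n

lemma Res.mono {I : Ideal (MvPolynomial σ K)} {d e : ℕ} (h : Res I d) (hde : d ≤ e) : Res I e := by
  obtain ⟨X, hX, hd⟩ := h
  exact ⟨X, hX, fun n k => (hd n k).trans (by omega)⟩

lemma res_bot (d : ℕ) : Res (⊥ : Ideal (MvPolynomial σ K)) d :=
  ⟨triv K σ, triv_resolves, fun _ _ => Nat.zero_le _⟩

lemma Res.cone {I J Q : Ideal (MvPolynomial σ K)} {f : MvPolynomial σ K} {d : ℕ}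
    (hQ : Res Q d) (hJ : Res J (d + 1)) (hJQ : J ≤ Q) (hf : f.IsHomogeneous 1)
    (hreg : ∀ p, f * p ∈ J → p ∈ J) (hfne : f ≠ 0)
    (hI : ∀ p, p ∈ I ↔ ∃ q ∈ Q, ∃ j ∈ J, p = f * q + j) : Res I (d + 1) := by
  obtain ⟨A, hA, hAd⟩ := hQ
  obtain ⟨B, hB, hBd⟩ := hJ
  obtain ⟨φ, h0, hg, hφ⟩ := comparison B A hA (J := J) (fun j => (hB.range_zero _).2
    ⟨Pi.single j 1, funext fun i => by rw [B.hz i]; simp⟩) hJQ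
  refine ⟨RegAux.cone hf hg h0 hφ, cone_resolves hf hg h0 hφ hA hB hreg hfne hI, fun n k => ?_⟩
  cases n with
  | zero => exact hBd 0 k
  | succ n =>
    rcases k with k | k | k
    · have := hAd (n + 1) k
      show A.deg (n + 1) k + 1 ≤ _
      omega
    · exact hBd (n + 1) k
    · have := hBd n k.1
      show B.deg n k.1 + 1 ≤ _
      omega

lemma Res.kos {I J : Ideal (MvPolynomial σ K)} {f : MvPolynomial σ K} {d : ℕ}
    (hJ : Res J d) (hf : f.IsHomogeneous 1) (hreg : ∀ p, f * p ∈ J → p ∈ J)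
    (hI : ∀ p, p ∈ I ↔ ∃ q, ∃ j ∈ J, p = f * q + j) : Res I d := by
  obtain ⟨B, hB, hBd⟩ := hJ
  refine ⟨RegAux.kos B hf, kos_resolves hf hB hreg hI, fun n k => ?_⟩
  cases n with
  | zero => exact hBd 0 k
  | succ n =>
    rcases k with k | k
    · exact hBd (n + 1) k
    · have := hBd n k
      show B.deg n k + 1 ≤ _
      omega

open EdgeIdealReg in
lemma Res.toResolution {I : Ideal (MvPolynomial σ K)} {d : ℕ} (h : Res I d) :
    ∃ F : GradedFreeResolution I, ∀ i (k : Fin (F.rank i)), (F.deg i k : ℤ) ≤ (d : ℤ) + i := by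
  obtain ⟨X, hX, hd⟩ := h
  let e : ∀ n, X.ι n ≃ Fin (Fintype.card (X.ι n)) := fun n => Fintype.equivFin _
  have hmv : ∀ n (w : Fin (Fintype.card (X.ι (n + 1))) → MvPolynomial σ K),
      ((X.mat n).submatrix (e n).symm (e (n + 1)).symm).mulVec w =
        ((X.mat n).mulVec (w ∘ e (n + 1))) ∘ (e n).symm := by
    intro n w
    rw [Matrix.submatrix_mulVec_equiv]
    rfl
  refine ⟨{ rank := fun n => Fintype.card (X.ι n)
            deg := fun n k => X.deg n ((e n).symm k)
            rank_zero := Fintype.card_eq_one_iff.2 ⟨X.z, X.hz⟩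
            deg_zero := fun k => by rw [X.hz ((e 0).symm k), X.deg_z]
            mat := fun n => (X.mat n).submatrix (e n).symm (e (n + 1)).symm
            homog := fun i k j => X.homog i _ _
            range_zero := fun f => ?_
            isExact := fun n => ?_ }, fun i k => ?_⟩
  · rw [hX.range_zero]
    constructor
    · rintro ⟨w, hw⟩
      refine ⟨w ∘ (e 1).symm, ?_⟩
      rw [Matrix.mulVecLin_apply] at hw ⊢
      rw [hmv, Function.comp_assoc, Equiv.symm_comp_self, Function.comp_id, hw]
      rfl
    · rintro ⟨w, hw⟩
      refine ⟨w ∘ e 1, ?_⟩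
      rw [Matrix.mulVecLin_apply] at hw ⊢
      rw [hmv] at hw
      funext i
      have := congrFun hw (e 0 i)
      simpa using this
  · ext v
    simp only [LinearMap.mem_ker, LinearMap.mem_range, Matrix.mulVecLin_apply, hmv]
    constructor
    · intro h
      obtain ⟨w, hw⟩ := hX.exact n (v ∘ e (n + 1)) (by
        funext i
        have := congrFun h (e n i)
        simpa using this)
      refine ⟨w ∘ (e (n + 2)).symm, ?_⟩
      rw [Function.comp_assoc, Equiv.symm_comp_self, Function.comp_id, ← hw,
        Function.comp_assoc, Equiv.self_comp_symm, Function.comp_id]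
    · rintro ⟨w, rfl⟩
      rw [Function.comp_assoc, Equiv.symm_comp_self, Function.comp_id, mulVec_zero_apply]
      rfl
  · exact_mod_cast hd i _

end RegAux

namespace RegAux
open scoped Classical
variable {K σ : Type} [Field K]

/-- `J` is a monomial ideal with generators not involving the variable `x`. -/
def NoVar (x : σ) (J : Ideal (MvPolynomial σ K)) : Prop :=
  ∃ S : Set (σ →₀ ℕ), J = Ideal.span ((fun s => monomial s (1 : K)) '' S) ∧ ∀ s ∈ S, s x = 0

lemma NoVar.reg {x : σ} {J : Ideal (MvPolynomial σ K)} (h : NoVar x J) (p : MvPolynomial σ K)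
    (hp : X x * p ∈ J) : p ∈ J := by
  obtain ⟨S, rfl, hS⟩ := h
  rw [mem_ideal_span_monomial_image] at hp ⊢
  intro m hm
  obtain ⟨s, hs, hle⟩ := hp (Finsupp.single x 1 + m) (by
    rw [mem_support_iff, coeff_X_mul]
    exact mem_support_iff.1 hm)
  refine ⟨s, hs, fun y => ?_⟩
  by_cases hy : y = x
  · rw [hy, hS s hs]; exact Nat.zero_le _
  · have := hle y
    rwa [Finsupp.add_apply, Finsupp.single_eq_of_ne hy, zero_add] at this

lemma NoVar.span {x : σ} {A : Set (MvPolynomial σ K)}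
    (h : ∀ p ∈ A, ∃ s : σ →₀ ℕ, p = monomial s 1 ∧ s x = 0) : NoVar x (Ideal.span A) := by
  refine ⟨{s | s x = 0 ∧ monomial s (1 : K) ∈ A}, ?_, fun s hs => hs.1⟩
  congr 1
  ext p
  constructor
  · intro hp
    obtain ⟨s, rfl, hs⟩ := h p hp
    exact ⟨s, ⟨hs, hp⟩, rfl⟩
  · rintro ⟨s, hs, rfl⟩
    exact hs.2

lemma NoVar.sup {x : σ} {I J : Ideal (MvPolynomial σ K)} (hI : NoVar x I) (hJ : NoVar x J) :
    NoVar x (I ⊔ J) := by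
  obtain ⟨S, rfl, hS⟩ := hI
  obtain ⟨T, rfl, hT⟩ := hJ
  refine ⟨S ∪ T, ?_, ?_⟩
  · rw [Set.image_union, Ideal.span_union]
  · rintro s (hs | hs)
    · exact hS s hs
    · exact hT s hs

lemma X_mul_X_eq (a b : σ) : (X a * X b : MvPolynomial σ K) =
    monomial (Finsupp.single a 1 + Finsupp.single b 1) 1 := by
  simp [X, monomial_mul]

/-- edge ideal of a set of edges -/
def CI (K : Type) [Field K] (M : Finset (Sym2 σ)) : Ideal (MvPolynomial σ K) :=
  Ideal.span {p | ∃ a b, s(a, b) ∈ M ∧ p = X a * X b}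

lemma CI_noVar {M : Finset (Sym2 σ)} {x : σ} (hx : ∀ e ∈ M, x ∉ e) : NoVar x (CI K M) := by
  apply NoVar.span
  rintro p ⟨a, b, hab, rfl⟩
  refine ⟨_, X_mul_X_eq a b, ?_⟩
  have := hx _ hab
  rw [Sym2.mem_iff, not_or] at this
  simp [Finsupp.single_eq_of_ne this.1, Finsupp.single_eq_of_ne this.2]

/-- Koszul-type resolution of the ideal of a matching -/
structure KT (T : GC K σ) (M : Finset (Sym2 σ)) : Prop where
  res : T.Resolves (CI K M)
  top : ∃ t : T.ι M.card, (∀ k, k = t) ∧ T.deg _ t = 2 * M.card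
  emp : ∀ n, M.card < n → IsEmpty (T.ι n)
  cc : ∀ n i j, constantCoeff (T.mat n i j) = 0
  fix : ∀ (ρ : MvPolynomial σ K →ₐ[K] MvPolynomial σ K),
    (∀ e ∈ M, ∀ a ∈ e, ρ (X a) = X a) → ∀ n i j, ρ (T.mat n i j) = T.mat n i j

lemma exists_KT (M : Finset (Sym2 σ)) (hd : ∀ e ∈ M, ¬ e.IsDiag)
    (hM : (M : Set (Sym2 σ)).Pairwise fun e f => ∀ v, v ∈ e → v ∉ f) :
    ∃ T : GC K σ, KT T M := by
  induction M using Finset.induction_on with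
  | empty =>
    refine ⟨triv K σ, ?_, ⟨⟨(), rfl⟩, fun _ => rfl, rfl⟩, ?_, ?_, ?_⟩
    · have : CI K (∅ : Finset (Sym2 σ)) = ⊥ := by
        simp [CI]
      rw [this]; exact triv_resolves
    · intro n hn
      exact ⟨fun i => by have := i.2; simp at hn; omega⟩
    · intro n i j
      exact map_zero _
    · intro ρ _ n i j
      exact map_zero ρ
  | insert e M he ih =>
    obtain ⟨B, hB⟩ := ih (fun f hf => hd f (by simp [hf])) (hM.mono (by simp))
    induction e with
    | h a b =>
    have hab : a ≠ b := fun h => hd s(a, b) (by simp) (by simpa using h)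
    have hnot : ∀ v ∈ s(a, b), ∀ f ∈ M, v ∉ f := fun v hv f hf =>
      hM (by simp) (by simp [hf]) (fun h : s(a, b) = f => he (h ▸ hf)) v hv
    have hhom : (X a * X b : MvPolynomial σ K).IsHomogeneous 2 :=
      (isHomogeneous_X K a).mul (isHomogeneous_X K b)
    have hcard : (insert s(a, b) M).card = M.card + 1 := Finset.card_insert_of_notMem he
    refine ⟨kos B hhom, ?_, ?_, ?_, ?_, ?_⟩
    · refine kos_resolves hhom hB.res ?_ ?_
      · intro p hp
        rw [mul_assoc] at hp
        exact (CI_noVar (hnot b (by simp))).reg _ ((CI_noVar (hnot a (by simp))).reg _ hp)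
      · intro p
        have : CI K (insert s(a, b) M) = Ideal.span {X a * X b} ⊔ CI K M := by
          unfold CI
          rw [← Ideal.span_union]
          apply le_antisymm <;> rw [Ideal.span_le]
          · rintro q ⟨u, v, huv, rfl⟩
            apply Ideal.subset_span
            rw [Finset.mem_insert] at huv
            rcases huv with h | h
            · left
              rcases Sym2.eq_iff.1 h with ⟨rfl, rfl⟩ | ⟨rfl, rfl⟩
              · rfl
              · exact mul_comm _ _
            · exact Or.inr ⟨u, v, h, rfl⟩
          · rintro q (rfl | ⟨u, v, h, rfl⟩)
            · exact Ideal.subset_span ⟨a, b, by simp, rfl⟩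
            · exact Ideal.subset_span ⟨u, v, by simp [h], rfl⟩
        rw [this, Submodule.mem_sup]
        constructor
        · rintro ⟨y, hy, z, hz, rfl⟩
          obtain ⟨q, rfl⟩ := Ideal.mem_span_singleton'.1 hy
          exact ⟨q, z, hz, by ring⟩
        · rintro ⟨q, j, hj, rfl⟩
          exact ⟨_, Ideal.mem_span_singleton'.2 ⟨q, rfl⟩, j, hj, by ring⟩
    · rw [hcard]
      obtain ⟨t, ht, htd⟩ := hB.top
      refine ⟨Sum.inr t, ?_, ?_⟩
      · rintro (k | k)
        · exact ((hB.emp _ (Nat.lt_succ_self _)).false k).elim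
        · rw [ht k]
      · show B.deg _ t + 2 = _
        omega
    · rw [hcard]
      intro n hn
      cases n with
      | zero => omega
      | succ n =>
        constructor
        rintro (k | k)
        · exact (hB.emp _ (by omega)).false k
        · exact (hB.emp _ (by omega)).false k
    · intro n i j
      have hcf : constantCoeff (X a * X b : MvPolynomial σ K) = 0 := by simp
      cases n with
      | zero =>
        rcases j with j | j
        · exact hB.cc 0 i j
        · exact hcf
      | succ n =>
        rcases i with i | i <;> rcases j with j | j
        · exact hB.cc (n + 1) i j
        · show constantCoeff (if i = j then (X a * X b : MvPolynomial σ K) else 0) = 0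
          split_ifs
          · exact hcf
          · exact map_zero _
        · exact map_zero _
        · show constantCoeff (- B.mat n i j) = 0
          rw [map_neg, hB.cc, neg_zero]
    · intro ρ hρ n i j
      have hρB := hB.fix ρ (fun e he => hρ e (by simp [he]))
      have hcf : ρ (X a * X b : MvPolynomial σ K) = X a * X b := by
        rw [map_mul, hρ s(a, b) (by simp) a (by simp), hρ s(a, b) (by simp) b (by simp)]
      cases n with
      | zero =>
        rcases j with j | j
        · exact hρB 0 i j
        · exact hcf
      | succ n =>
        rcases i with i | i <;> rcases j with j | j
        · exact hρB (n + 1) i j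
        · show ρ (if i = j then (X a * X b : MvPolynomial σ K) else 0) =
            if i = j then (X a * X b : MvPolynomial σ K) else 0
          split_ifs
          · exact hcf
          · exact map_zero _
        · exact map_zero ρ
        · show ρ (- B.mat n i j) = - B.mat n i j
          rw [map_neg, hρB]

end RegAux

namespace RegAux
open scoped Classical
variable {K σ : Type} [Field K]

lemma Gr.map {ρ : MvPolynomial σ K →ₐ[K] MvPolynomial σ K}
    (hρ : ∀ (p : MvPolynomial σ K) n, p.IsHomogeneous n → (ρ p).IsHomogeneous n) {a b : ℕ}
    {p : MvPolynomial σ K} (h : Gr a b p) : Gr a b (ρ p) := by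
  rcases h with rfl | ⟨t, ht, hp⟩
  · rw [map_zero]; exact Gr.zero _ _
  · exact Or.inr ⟨t, ht, hρ _ _ hp⟩

/-- base change of a complex along a graded endomorphism -/
def GC.map (F : GC K σ) (ρ : MvPolynomial σ K →ₐ[K] MvPolynomial σ K)
    (hρ : ∀ (p : MvPolynomial σ K) n, p.IsHomogeneous n → (ρ p).IsHomogeneous n) : GC K σ where
  ι := F.ι
  ft := F.ft
  deg := F.deg
  z := F.z
  hz := F.hz
  deg_z := F.deg_z
  mat n := (F.mat n).map ρ
  homog n i j := (F.homog n i j).map hρ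
  sq n := by
    rw [← Matrix.map_mul, F.sq]
    simp

lemma GC.Resolves.mem {F : GC K σ} {I : Ideal (MvPolynomial σ K)} (hF : F.Resolves I) (j) :
    F.mat 0 F.z j ∈ I :=
  (hF.range_zero _).2 ⟨Pi.single j 1, funext fun i => by rw [F.hz i]; simp⟩

/-- null-homotopy of a chain map `β` with `β 0 = 0` at the top. -/
lemma homotopy {T : GC K σ} {I : Ideal (MvPolynomial σ K)} (hT : T.Resolves I)
    (β : ∀ n, Matrix (T.ι n) (T.ι n) (MvPolynomial σ K)) (h0 : β 0 = 0)
    (hβ : ∀ n, T.mat n * β (n + 1) = β n * T.mat n) (m : ℕ) :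
    ∃ (h : Matrix (T.ι (m + 1)) (T.ι m) (MvPolynomial σ K))
      (h' : Matrix (T.ι (m + 2)) (T.ι (m + 1)) (MvPolynomial σ K)),
      T.mat (m + 1) * h' = β (m + 1) - h * T.mat m := by
  obtain ⟨f, -, hf⟩ := exists_seq (α := fun n => Matrix (T.ι (n + 1)) (T.ι n) (MvPolynomial σ K))
    (P := fun n h => T.mat n * h * T.mat n = β n * T.mat n)
    (R := fun n h h' => T.mat (n + 1) * h' = β (n + 1) - h * T.mat n) 0 (by simp [h0])
    (by
      intro n h hP
      obtain ⟨h', hh'⟩ := exists_lift (N := T.mat (n + 1)) (P := β (n + 1) - h * T.mat n) (by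
        intro j
        obtain ⟨w, hw⟩ := hT.exact n (fun i => (β (n + 1) - h * T.mat n) i j) (by
          have : T.mat n * (β (n + 1) - h * T.mat n) = 0 := by
            rw [Matrix.mul_sub, hβ, ← Matrix.mul_assoc, hP, sub_self]
          funext i
          exact congrFun (congrFun this i) j)
        exact ⟨w, hw.symm⟩)
      refine ⟨h', ?_, hh'⟩
      rw [hh', Matrix.sub_mul, Matrix.mul_assoc h, T.sq, Matrix.mul_zero, sub_zero])
  exact ⟨f m, f (m + 1), (hf m).2⟩

lemma lower_aux {F : GC K σ} {I : Ideal (MvPolynomial σ K)} (hF : F.Resolves I)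
    {T : GC K σ} {M : Finset (Sym2 σ)} (hT : KT T M) (hMI : CI K M ≤ I)
    (ρ : MvPolynomial σ K →ₐ[K] MvPolynomial σ K)
    (hρ : ∀ (p : MvPolynomial σ K) n, p.IsHomogeneous n → (ρ p).IsHomogeneous n)
    (hfix : ∀ e ∈ M, ∀ a ∈ e, ρ (X a) = X a) (hρI : ∀ p ∈ I, ρ p ∈ CI K M)
    (hdeg : ∀ k, F.deg M.card k < 2 * M.card) : False := by
  obtain ⟨φ, φ0, φg, hφ⟩ := comparison T F hF (fun j => hT.res.mem j) hMI
  obtain ⟨ψ, ψ0, ψg, hψ⟩ := comparison (F.map ρ hρ) T hT.res (J := CI K M)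
    (fun j => hρI _ (hF.mem j)) le_rfl
  let α : ∀ n, Matrix (T.ι n) (T.ι n) (MvPolynomial σ K) := fun n =>
    (show Matrix (T.ι n) (F.ι n) (MvPolynomial σ K) from ψ n) * (φ n).map ρ
  have hTρ : ∀ n, (T.mat n).map ρ = T.mat n := fun n => by
    ext1 i j; exact hT.fix ρ hfix n i j
  have hρφ : ∀ n, (F.mat n).map ρ * (φ (n + 1)).map ρ = (φ n).map ρ * T.mat n := fun n => by
    rw [← Matrix.map_mul, hφ, Matrix.map_mul, hTρ]
  have hα : ∀ n, T.mat n * α (n + 1) = α n * T.mat n := fun n => by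
    have h1 : T.mat n * (show Matrix (T.ι (n + 1)) (F.ι (n + 1)) (MvPolynomial σ K) from ψ (n + 1))
      = (show Matrix (T.ι n) (F.ι n) (MvPolynomial σ K) from ψ n) * (F.mat n).map ρ := hψ n
    show T.mat n * (_ * _) = (_ * _) * T.mat n
    rw [← Matrix.mul_assoc, h1, Matrix.mul_assoc, hρφ, ← Matrix.mul_assoc]
  have hα0 : α 0 = 1 := by
    ext1 i j
    have hF1 : (Finset.univ : Finset (F.ι 0)) = {F.z} := by
      ext k; simp [F.hz k]
    have e : (α 0) i j = ∑ k : F.ι 0, ψ 0 i k * ρ (φ 0 k j) := rfl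
    rw [e, hF1, Finset.sum_singleton, φ0, ψ0, T.hz i, T.hz j]
    simp
    rfl
  cases hm : M.card with
  | zero =>
    rw [hm] at hdeg
    have := hdeg F.z
    omega
  | succ m =>
    obtain ⟨h, h', hh⟩ := homotopy hT.res (fun n => α n - 1) (by simp [hα0])
      (fun n => by rw [Matrix.mul_sub, Matrix.sub_mul, hα, Matrix.mul_one, Matrix.one_mul]) m
    have htop := hT.top
    have hemp := hT.emp (m + 2) (by omega)
    rw [hm] at htop hdeg
    obtain ⟨t, -, htd⟩ := htop
    have hz : T.mat (m + 1) * h' = 0 := by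
      ext1 i j
      rw [Matrix.mul_apply, Finset.univ_eq_empty, Finset.sum_empty]; rfl
    rw [hz] at hh
    have key := congrArg constantCoeff (congrFun (congrFun hh t) t)
    rw [Matrix.sub_apply, Matrix.sub_apply, Matrix.one_apply_eq, map_sub, map_sub] at key
    have c1 : constantCoeff ((h * T.mat m) t t) = 0 := by
      rw [Matrix.mul_apply, map_sum]
      exact Finset.sum_eq_zero fun k _ => by rw [map_mul, hT.cc, mul_zero]
    have c2 : constantCoeff (α (m + 1) t t) = 0 := by
      have e : (α (m + 1)) t t = ∑ k : F.ι (m + 1), ψ (m + 1) t k * ρ (φ (m + 1) k t) := rfl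
      rw [e, map_sum]
      refine Finset.sum_eq_zero fun k _ => ?_
      have := ((φg (m + 1) k t).map hρ).constantCoeff (by rw [htd]; exact hdeg k)
      rw [map_mul, this, mul_zero]
    rw [c1, c2] at key
    simp at key

open EdgeIdealReg

/-- convert -/
def ofRes {I : Ideal (MvPolynomial σ K)} (F : GradedFreeResolution I) : GC K σ where
  ι n := Fin (F.rank n)
  ft n := inferInstance
  deg := F.deg
  z := ⟨0, by rw [F.rank_zero]; exact Nat.one_pos⟩
  hz k := by
    have := F.rank_zero
    ext
    have := k.2
    show (k : ℕ) = 0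
    omega
  deg_z := F.deg_zero _
  mat := F.mat
  homog n i j := F.homog n i j
  sq n := by
    apply matrix_eq_zero_of_mulVec
    intro v
    rw [← Matrix.mulVec_mulVec]
    have : (F.mat (n + 1)).mulVec v ∈ LinearMap.ker (Matrix.mulVecLin (F.mat n)) := by
      rw [F.isExact]
      exact ⟨v, rfl⟩
    exact this

lemma ofRes_resolves {I : Ideal (MvPolynomial σ K)} (F : GradedFreeResolution I) :
    (ofRes F).Resolves I := by
  constructor
  · exact F.range_zero
  · intro n v hv
    have : v ∈ LinearMap.ker (Matrix.mulVecLin (F.mat n)) := hv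
    rw [F.isExact] at this
    obtain ⟨w, hw⟩ := this
    exact ⟨w, hw.symm⟩

lemma lower_bound (G : SimpleGraph σ) (F : GradedFreeResolution (edgeIdeal K G)) (d : ℤ)
    (hd : ∀ i (k : Fin (F.rank i)), (F.deg i k : ℤ) ≤ d + i)
    (M : Finset (Sym2 σ)) (hM : IsInducedMatchingSet G M) : (M.card : ℤ) ≤ d := by
  by_contra hlt
  push Not at hlt
  obtain ⟨T, hT⟩ := exists_KT (K := K) M (fun e he => G.not_isDiag_of_mem_edgeSet (hM.1.1 he)) hM.1.2
  let g : σ → MvPolynomial σ K := fun v => if ∃ e ∈ M, v ∈ e then X v else 0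
  have hg : ∀ v, (g v).IsHomogeneous 1 := fun v => by
    simp only [g]
    split_ifs
    · exact isHomogeneous_X _ _
    · exact isHomogeneous_zero _ _ _
  refine lower_aux (ofRes_resolves F) hT ?_ (aeval g) ?_ ?_ ?_ ?_
  · unfold CI edgeIdeal
    rw [Ideal.span_le]
    rintro p ⟨a, b, hab, rfl⟩
    exact Ideal.subset_span ⟨a, b, hM.1.1 hab, rfl⟩
  · intro p n hp
    have := hp.aeval g hg
    rwa [one_mul] at this
  · intro e he a ha
    rw [aeval_X]
    exact if_pos ⟨e, he, ha⟩
  · intro p hp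
    have : edgeIdeal K G ≤ (CI K M).comap (aeval g) := by
      unfold edgeIdeal
      rw [Ideal.span_le]
      rintro p ⟨a, b, hab, rfl⟩
      show aeval g (X a * X b) ∈ CI K M
      rw [map_mul, aeval_X, aeval_X]
      simp only [g]
      split_ifs with h1 h2
      · obtain ⟨e, he, hae⟩ := h1
        obtain ⟨f, hf, hbf⟩ := h2
        have hef : e = f := by
          by_contra hne
          exact hM.2 he hf hne a b hae hbf hab
        subst hef
        have : e = s(a, b) := (Sym2.mem_and_mem_iff hab.ne).1 ⟨hae, hbf⟩
        exact Ideal.subset_span ⟨a, b, this ▸ he, rfl⟩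
      all_goals simp
    exact this hp
  · intro k
    have := hd M.card k
    have h2 : ((ofRes F).deg M.card k : ℤ) ≤ d + M.card := this
    omega

end RegAux

namespace RegAux
open scoped Classical
variable {K V : Type} [Field K]
open EdgeIdealReg

lemma edgeIdealOn_noVar (G : SimpleGraph V) (W : Set V) {x : V} (hx : x ∉ W) :
    NoVar x (edgeIdealOn K G W) := by
  apply NoVar.span
  rintro p ⟨u, v, -, hu, hv, rfl⟩
  refine ⟨_, X_mul_X_eq u v, ?_⟩
  have h1 : x ≠ u := fun h => hx (h ▸ hu)
  have h2 : x ≠ v := fun h => hx (h ▸ hv)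
  simp [Finsupp.single_eq_of_ne h1, Finsupp.single_eq_of_ne h2]

lemma edgeIdealOn_mono (G : SimpleGraph V) {W U : Set V} (h : W ⊆ U) :
    edgeIdealOn K G W ≤ edgeIdealOn K G U := by
  apply Ideal.span_mono
  rintro p ⟨u, v, h1, hu, hv, rfl⟩
  exact ⟨u, v, h1, h hu, h hv, rfl⟩

lemma res_vars (G : SimpleGraph V) (W : Set V) (A : Finset V) (hA : ∀ a ∈ A, a ∉ W) {d : ℕ}
    (h : Res (edgeIdealOn K G W) d) :
    Res (edgeIdealOn K G W ⊔ Ideal.span {p | ∃ a ∈ A, p = X a}) d ∧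
      ∀ x, x ∉ A → x ∉ W → NoVar x (edgeIdealOn K G W ⊔ Ideal.span {p | ∃ a ∈ A, p = X a}) := by
  constructor
  swap
  · intro x hxA hxW
    refine (edgeIdealOn_noVar G W hxW).sup (NoVar.span ?_)
    rintro p ⟨a, ha, rfl⟩
    refine ⟨Finsupp.single a 1, rfl, ?_⟩
    exact Finsupp.single_eq_of_ne (fun h => hxA (h ▸ ha))
  induction A using Finset.induction_on with
  | empty => simpa using h
  | insert a A ha ih =>
    refine (ih fun b hb => hA b (by simp [hb])).kos (isHomogeneous_X K a) ?_ ?_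
    · apply NoVar.reg
      refine (edgeIdealOn_noVar G W (hA a (by simp))).sup (NoVar.span ?_)
      rintro p ⟨b, hb, rfl⟩
      refine ⟨Finsupp.single b 1, rfl, ?_⟩
      exact Finsupp.single_eq_of_ne (fun h => ha (h ▸ hb))
    · intro p
      have : Ideal.span {p : MvPolynomial V K | ∃ b ∈ insert a A, p = X b} =
          Ideal.span {X a} ⊔ Ideal.span {p | ∃ b ∈ A, p = X b} := by
        rw [← Ideal.span_union]
        congr 1
        ext q
        simp
      rw [this, sup_left_comm, Submodule.mem_sup]
      constructor
      · rintro ⟨y, hy, z, hz, rfl⟩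
        obtain ⟨q, rfl⟩ := Ideal.mem_span_singleton'.1 hy
        exact ⟨q, z, hz, by ring⟩
      · rintro ⟨q, j, hj, rfl⟩
        exact ⟨_, Ideal.mem_span_singleton'.2 ⟨q, rfl⟩, j, hj, by ring⟩

/-- vertices of `W` outside the closed neighbourhood of `x` -/
def far (G : SimpleGraph V) (W : Finset V) (x : V) : Finset V :=
  W.filter fun y => y ≠ x ∧ ¬ G.Adj x y

lemma mem_far {G : SimpleGraph V} {W : Finset V} {x y : V} :
    y ∈ far G W x ↔ y ∈ W ∧ y ≠ x ∧ ¬ G.Adj x y := by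
  simp [far]

lemma edgeIdealOn_eq (G : SimpleGraph V) (W : Finset V) (x : V)
    (Q : Ideal (MvPolynomial V K))
    (hQ1 : ∀ a ∈ W, G.Adj x a → (X a : MvPolynomial V K) ∈ Q)
    (hQ2 : Ideal.span {X x} * Q ≤ edgeIdealOn K G W) :
    edgeIdealOn K G W = Ideal.span {X x} * Q ⊔ edgeIdealOn K G (W.erase x) := by
  apply le_antisymm
  · refine Ideal.span_le.2 ?_
    rintro p ⟨u, v, huv, hu, hv, rfl⟩
    rw [Finset.mem_coe] at hu hv
    by_cases h1 : u = x
    · rw [h1] at huv ⊢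
      exact Ideal.mem_sup_left (Ideal.mem_span_singleton_mul.2 ⟨X v, hQ1 v hv huv, rfl⟩)
    by_cases h2 : v = x
    · rw [h2] at huv ⊢
      exact Ideal.mem_sup_left (Ideal.mem_span_singleton_mul.2
        ⟨X u, hQ1 u hu huv.symm, mul_comm _ _⟩)
    · refine Ideal.mem_sup_right (Ideal.subset_span ⟨u, v, huv, ?_, ?_, rfl⟩)
      · exact Finset.mem_coe.2 (Finset.mem_erase.2 ⟨h1, hu⟩)
      · exact Finset.mem_coe.2 (Finset.mem_erase.2 ⟨h2, hv⟩)
  · exact sup_le hQ2 (edgeIdealOn_mono G (Finset.coe_subset.2 (Finset.erase_subset _ _)))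

lemma erase_le (G : SimpleGraph V) (W : Finset V) (x : V) (Q : Ideal (MvPolynomial V K))
    (hQ1 : ∀ a ∈ W, G.Adj x a → (X a : MvPolynomial V K) ∈ Q)
    (hQ2 : edgeIdealOn K G (far G W x) ≤ Q) : edgeIdealOn K G (W.erase x) ≤ Q := by
  refine Ideal.span_le.2 ?_
  rintro p ⟨u, v, huv, hu, hv, rfl⟩
  rw [Finset.mem_coe, Finset.mem_erase] at hu hv
  by_cases h1 : G.Adj x u
  · exact Ideal.mul_mem_right _ _ (hQ1 u hu.2 h1)
  by_cases h2 : G.Adj x v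
  · exact Ideal.mul_mem_left _ _ (hQ1 v hv.2 h2)
  · refine hQ2 (Ideal.subset_span ⟨u, v, huv, ?_, ?_, rfl⟩)
    · exact mem_far.2 ⟨hu.2, hu.1, h1⟩
    · exact mem_far.2 ⟨hv.2, hv.1, h2⟩

lemma res_step (G : SimpleGraph V) (W : Finset V) (x : V) (hx : x ∈ W) (d : ℕ)
    (h1 : Res (edgeIdealOn K G (far G W x)) d)
    (h2 : Res (edgeIdealOn K G (W.erase x)) (d + 1)) :
    Res (edgeIdealOn K G W) (d + 1) := by
  obtain ⟨A, hA⟩ : ∃ A, A = W.filter (fun y => G.Adj x y) := ⟨_, rfl⟩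
  have hQ := (res_vars G (far G W x) A (by
    intro a ha h
    rw [hA, Finset.mem_filter] at ha
    exact (mem_far.1 h).2.2 ha.2) h1).1
  obtain ⟨Q, hQd⟩ : ∃ Q, Q = edgeIdealOn K G (far G W x) ⊔ Ideal.span {p | ∃ a ∈ A, p = X a} :=
    ⟨_, rfl⟩
  rw [← hQd] at hQ
  have hvar : ∀ a ∈ W, G.Adj x a → (X a : MvPolynomial V K) ∈ Q := fun a ha hxa => by
    rw [hQd]
    refine Ideal.mem_sup_right (Ideal.subset_span ⟨a, ?_, rfl⟩)
    rw [hA]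
    exact Finset.mem_filter.2 ⟨ha, hxa⟩
  have key := edgeIdealOn_eq G W x Q hvar (by
    rw [hQd, Ideal.mul_sup]
    refine sup_le ?_ ?_
    · have hs : (far G W x : Set V) ⊆ (W : Set V) := fun y hy => (mem_far.1 hy).1
      have hm := edgeIdealOn_mono (K := K) G hs
      intro p hp
      obtain ⟨z, hz, rfl⟩ := Ideal.mem_span_singleton_mul.1 hp
      exact Ideal.mul_mem_left _ _ (hm hz)
    · rw [Ideal.span_mul_span', Ideal.span_le]
      rintro p ⟨y, rfl, z, ⟨a, ha, rfl⟩, rfl⟩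
      rw [hA, Finset.mem_filter] at ha
      exact Ideal.subset_span ⟨x, a, ha.2, hx, ha.1, rfl⟩)
  refine hQ.cone h2 (erase_le G W x Q hvar (by rw [hQd]; exact le_sup_left))
    (isHomogeneous_X K x) (NoVar.reg (edgeIdealOn_noVar G _ (by simp)))
    (X_ne_zero x) ?_
  intro p
  rw [key, Submodule.mem_sup]
  constructor
  · rintro ⟨y, hy, z, hz, rfl⟩
    obtain ⟨q, hq, rfl⟩ := Ideal.mem_span_singleton_mul.1 hy
    exact ⟨q, hq, z, hz, rfl⟩
  · rintro ⟨q, hq, j, hj, rfl⟩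
    exact ⟨_, Ideal.mem_span_singleton_mul.2 ⟨q, hq, rfl⟩, j, hj, rfl⟩

lemma res_edgeless (G : SimpleGraph V) (W : Finset V) (h : ∀ u ∈ W, ∀ v ∈ W, ¬ G.Adj u v) (d : ℕ) :
    Res (edgeIdealOn K G W) d := by
  have : edgeIdealOn K G (W : Set V) = ⊥ := by
    unfold edgeIdealOn
    rw [Ideal.span_eq_bot]
    rintro p ⟨u, v, huv, hu, hv, rfl⟩
    exact absurd huv (h u hu v hv)
  rw [this]
  exact res_bot d

/-- induced matchings contained in `W` -/
def IMin (G : SimpleGraph V) (W : Finset V) (M : Finset (Sym2 V)) : Prop :=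
  IsInducedMatchingSet G M ∧ ∀ e ∈ M, ∀ v ∈ e, v ∈ W

lemma IMin.mono {G : SimpleGraph V} {W U : Finset V} {M : Finset (Sym2 V)} (h : IMin G W M)
    (hWU : W ⊆ U) : IMin G U M := ⟨h.1, fun e he v hv => hWU (h.2 e he v hv)⟩

/-- every induced matching of `W` has at most `d` edges -/
def BD (G : SimpleGraph V) (W : Finset V) (d : ℕ) : Prop := ∀ M, IMin G W M → M.card ≤ d

lemma BD.mono {G : SimpleGraph V} {W U : Finset V} {d : ℕ} (h : BD G U d) (hWU : W ⊆ U) :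
    BD G W d := fun M hM => h M (hM.mono hWU)

/-- extend an induced matching by an edge `zx` with `N[z] ∩ W ⊆ N[x]` -/
lemma IMin.extend {G : SimpleGraph V} {W : Finset V} {x z : V} (hx : x ∈ W) (hz : z ∈ W)
    (hzx : G.Adj z x) (hN : ∀ y ∈ W, G.Adj z y → y = x ∨ G.Adj x y) {U : Finset V} (hU : U ⊆ W)
    {M : Finset (Sym2 V)} (hM : IMin G U M) (hUx : U ⊆ far G W x) (hzU : z ∈ U → False) :
    ∃ M', IMin G W M' ∧ M'.card = M.card + 1 ∧ ∀ e ∈ M', e ∈ M ∨ e = s(z, x) := by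
  have hfar : ∀ e ∈ M, ∀ v ∈ e, v ∈ W ∧ v ≠ x ∧ ¬ G.Adj x v := fun e he v hv =>
    mem_far.1 (hUx (hM.2 e he v hv))
  have hfz : ∀ e ∈ M, ∀ v ∈ e, ¬ G.Adj z v := fun e he v hv h => by
    rcases hN v (hfar e he v hv).1 h with h' | h'
    · exact (hfar e he v hv).2.1 h'
    · exact (hfar e he v hv).2.2 h'
  have hnz : ∀ e ∈ M, ∀ v ∈ e, v ≠ z := fun e he v hv h => hzU (h ▸ hM.2 e he v hv)
  have hnot : s(z, x) ∉ M := fun h => hnz _ h z (by simp) rfl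
  refine ⟨insert s(z, x) M, ⟨⟨⟨?_, ?_⟩, ?_⟩, ?_⟩, Finset.card_insert_of_notMem hnot, ?_⟩
  · intro e he
    rcases Finset.mem_insert.1 (Finset.mem_coe.1 he) with rfl | he
    · exact hzx
    · exact hM.1.1.1 he
  · rw [Finset.coe_insert, Set.pairwise_insert]
    have : ∀ e ∈ M, ∀ v ∈ s(z, x), v ∉ e := fun e he v hv hve => by
      rcases Sym2.mem_iff.1 hv with rfl | rfl
      · exact hnz e he _ hve rfl
      · exact (hfar e he _ hve).2.1 rfl
    exact ⟨hM.1.1.2, fun e he _ => ⟨this e he, fun v hv hv' => this e he v hv' hv⟩⟩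
  · rw [Finset.coe_insert, Set.pairwise_insert]
    have : ∀ e ∈ M, ∀ u v, u ∈ s(z, x) → v ∈ e → ¬ G.Adj u v := fun e he u v hu hve => by
      rcases Sym2.mem_iff.1 hu with rfl | rfl
      · exact hfz e he _ hve
      · exact (hfar e he _ hve).2.2
    exact ⟨hM.1.2, fun e he _ => ⟨this e he, fun u v hu hv h => this e he v u hv hu h.symm⟩⟩
  · intro e he v hv
    rcases Finset.mem_insert.1 he with rfl | he
    · rcases Sym2.mem_iff.1 hv with rfl | rfl
      · exact hz
      · exact hx
    · exact hU (hM.2 e he v hv)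
  · intro e he
    rcases Finset.mem_insert.1 he with rfl | he
    · exact Or.inr rfl
    · exact Or.inl he

end RegAux

namespace RegAux
open scoped Classical
variable {K V : Type} [Field K]
open EdgeIdealReg

/-- `z` is a simplicial vertex of the graph induced on `W`, with neighbour `x` -/
structure Simp (G : SimpleGraph V) (W : Finset V) (z x : V) : Prop where
  hz : z ∈ W
  hx : x ∈ W
  adj : G.Adj z x
  cl : ∀ y ∈ W, ∀ y' ∈ W, G.Adj z y → G.Adj z y' → y = y' ∨ G.Adj y y'

lemma Simp.mono {G : SimpleGraph V} {W U : Finset V} {z x : V} (h : Simp G W z x)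
    (hU : U ⊆ W) (hz : z ∈ U) (hx : x ∈ U) : Simp G U z x :=
  ⟨hz, hx, h.adj, fun y hy y' hy' => h.cl y (hU hy) y' (hU hy')⟩

lemma Simp.bd {G : SimpleGraph V} {W : Finset V} {z x : V} (h : Simp G W z x) {d : ℕ}
    (hd : BD G W d) : ∃ d', d = d' + 1 ∧ BD G (far G W x) d' := by
  have key : ∀ M, IMin G (far G W x) M → M.card + 1 ≤ d := fun M hM => by
    obtain ⟨M', h1, h2, -⟩ := IMin.extend h.hx h.hz h.adj (fun y hy hzy => by
      rcases h.cl y hy x h.hx hzy h.adj with h | h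
      · exact Or.inl h
      · exact Or.inr h.symm) (U := far G W x) (fun y hy => (mem_far.1 hy).1) hM subset_rfl
      (fun hz => (mem_far.1 hz).2.2 h.adj.symm)
    rw [← h2]
    exact hd M' h1
  have h0 : IMin G (far G W x) ∅ := by
    simp [IMin, IsInducedMatchingSet, IsMatchingSet]
  have := key ∅ h0
  refine ⟨d - 1, by omega, fun M hM => ?_⟩
  have := key M hM
  omega

lemma card_far_lt {G : SimpleGraph V} {W : Finset V} {x : V} (hx : x ∈ W) :
    (far G W x).card < W.card := by
  apply Finset.card_lt_card
  refine ⟨fun y hy => (mem_far.1 hy).1, fun h => (mem_far.1 (h hx)).2.1 rfl⟩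

variable (G : SimpleGraph V) (cyc : Set V)

lemma chordal_res
    (hS1 : ∀ W : Finset V, ¬ cyc ⊆ W → (∃ u ∈ W, ∃ v ∈ W, G.Adj u v) → ∃ z x, Simp G W z x)
    (n : ℕ) : ∀ (W : Finset V) (d : ℕ), W.card = n → ¬ cyc ⊆ W → BD G W d →
      Res (edgeIdealOn K G W) d := by
  induction n using Nat.strong_induction_on with
  | _ n ih =>
    rintro W d rfl hW hd
    by_cases hE : ∃ u ∈ W, ∃ v ∈ W, G.Adj u v
    · obtain ⟨z, x, hzx⟩ := hS1 W hW hE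
      obtain ⟨d', rfl, hd'⟩ := hzx.bd hd
      have hfs : far G W x ⊆ W := fun y hy => (mem_far.1 hy).1
      refine res_step G W x hzx.hx d' ?_ ?_
      · exact ih _ (card_far_lt hzx.hx) _ d' rfl
          (fun h => hW (h.trans (Finset.coe_subset.2 hfs))) hd'
      · exact ih _ (Finset.card_erase_lt_of_mem hzx.hx) _ _ rfl
          (fun h => hW (h.trans (Finset.coe_subset.2 (Finset.erase_subset _ _))))
          (hd.mono (Finset.erase_subset _ _))
    · push Not at hE
      exact res_edgeless G W hE d

/-- the part of `W` outside `Γ` -/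
def outΓ (W : Finset V) : Finset V := W.filter fun w => w ∈ cyc ∨ ∀ y ∈ cyc, ¬ G.Adj y w

lemma main_res
    (hne : cyc.Nonempty)
    (hS1 : ∀ W : Finset V, ¬ cyc ⊆ W → (∃ u ∈ W, ∃ v ∈ W, G.Adj u v) → ∃ z x, Simp G W z x)
    (hS2 : ∀ W : Finset V, cyc ⊆ W → (∃ u ∈ W, u ∉ cyc ∧ ∃ v ∈ W, G.Adj u v) →
      ∃ z x, z ∉ cyc ∧ Simp G W z x)
    (n : ℕ) : ∀ (W : Finset V) (d : ℕ), W.card = n → cyc ⊆ W → BD G W d →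
      (∀ M, IMin G (outΓ G cyc W) M → M.card + 1 ≤ d) → Res (edgeIdealOn K G W) d := by
  induction n using Nat.strong_induction_on with
  | _ n ih =>
    rintro W d rfl hW hd hΓ
    have h0 : ∀ U, IMin G U ∅ := fun U => by
      simp [IMin, IsInducedMatchingSet, IsMatchingSet]
    by_cases hE : ∃ w ∈ W, w ∉ cyc ∧ ∃ y ∈ cyc, G.Adj y w
    · obtain ⟨w, hw, hwc, y, hy, hyw⟩ := hE
      obtain ⟨z, x, hzc, hzx⟩ := hS2 W hW ⟨w, hw, hwc, y, hW hy, hyw.symm⟩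
      obtain ⟨d', rfl, hd'⟩ := hzx.bd hd
      have hfs : far G W x ⊆ W := fun y hy => (mem_far.1 hy).1
      refine res_step G W x hzx.hx d' ?_ ?_
      · by_cases hcf : cyc ⊆ far G W x
        · refine ih _ (card_far_lt hzx.hx) _ d' rfl hcf hd' fun M hM => ?_
          have hxΓ : ∀ y ∈ cyc, ¬ G.Adj y x := fun y hy h => (mem_far.1 (hcf hy)).2.2 h.symm
          have hzΓ : ∀ y ∈ cyc, ¬ G.Adj y z := fun y hy h => by
            rcases hzx.cl y (hW hy) x hzx.hx h.symm hzx.adj with h' | h'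
            · exact (mem_far.1 (hcf hy)).2.1 h'
            · exact hxΓ y hy h'
          have hos : outΓ G cyc W ⊆ W := Finset.filter_subset _ _
          have hz' : z ∈ outΓ G cyc W := Finset.mem_filter.2 ⟨hzx.hz, Or.inr hzΓ⟩
          have hx' : x ∈ outΓ G cyc W := Finset.mem_filter.2 ⟨hzx.hx, Or.inr hxΓ⟩
          have hs := hzx.mono hos hz' hx'
          have hsub : outΓ G cyc (far G W x) ⊆ far G (outΓ G cyc W) x := fun y hy => by
            have h1 := Finset.mem_filter.1 hy
            have h2 := mem_far.1 h1.1
            exact mem_far.2 ⟨Finset.mem_filter.2 ⟨h2.1, h1.2⟩, h2.2⟩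
          have hB : BD G (outΓ G cyc W) d' := fun M hM => by
            have := hΓ M hM
            omega
          obtain ⟨d'', rfl, hd''⟩ := hs.bd hB
          have := hd'' M (hM.mono hsub)
          omega
        · exact chordal_res G cyc hS1 _ _ _ rfl hcf hd'
      · by_cases hxc : x ∈ cyc
        · exact chordal_res G cyc hS1 _ _ _ rfl (fun h => by simpa using h hxc)
            (hd.mono (Finset.erase_subset _ _))
        · refine ih _ (Finset.card_erase_lt_of_mem hzx.hx) _ _ rfl ?_
            (hd.mono (Finset.erase_subset _ _)) fun M hM => hΓ M (hM.mono ?_)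
          · intro y hy
            exact Finset.mem_coe.2 (Finset.mem_erase.2 ⟨fun h => hxc (h ▸ hy), hW hy⟩)
          · exact Finset.filter_subset_filter _ (Finset.erase_subset _ _)
    · push Not at hE
      have hout : outΓ G cyc W = W := by
        refine Finset.filter_true_of_mem fun w hw => ?_
        by_cases hwc : w ∈ cyc
        · exact Or.inl hwc
        · exact Or.inr (hE w hw hwc)
      rw [hout] at hΓ
      obtain ⟨y, hy⟩ := hne
      have := hΓ ∅ (h0 _)
      obtain ⟨d', rfl⟩ : ∃ d', d = d' + 1 := ⟨d - 1, by omega⟩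
      have hfs : far G W y ⊆ W := fun y hy => (mem_far.1 hy).1
      refine res_step G W y (hW hy) d' ?_ ?_
      · refine chordal_res G cyc hS1 _ _ _ rfl (fun h => (mem_far.1 (h hy)).2.1 rfl) ?_
        intro M hM
        have := hΓ M (hM.mono hfs)
        omega
      · exact chordal_res G cyc hS1 _ _ _ rfl (fun h => by simpa using h hy)
            (hd.mono (Finset.erase_subset _ _))

end RegAux

namespace RegAux
open scoped Classical
open EdgeIdealReg

section leaf
variable {U : Type}

lemma leaf_start {D : SimpleGraph U} (hD : D.IsAcyclic) {u v : U} {p : D.Walk u v}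
    (hp : p.IsPath) (hmax : ∀ (u' v' : U) (p' : D.Walk u' v') (_ : p'.IsPath),
      p'.length ≤ p.length) (hnil : ¬ p.Nil) : ∃ x, D.Adj u x ∧ ∀ y, D.Adj u y → y = x := by
  refine ⟨p.snd, p.adj_snd hnil, fun y hy => ?_⟩
  by_cases hs : y ∈ p.support
  · exact hD.eq_snd_of_adj_start hp hy hs
  · have := hmax y v (SimpleGraph.Walk.cons hy.symm p) (hp.cons hs)
    rw [SimpleGraph.Walk.length_cons] at this
    omega

lemma leaf [Finite U] {D : SimpleGraph U} (hD : D.IsAcyclic) (Z : Set U)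
    (hZ : ∀ a ∈ Z, ∀ b ∈ Z, D.Reachable a b → a = b) {a b : U} (hab : D.Adj a b) :
    ∃ z x, z ∉ Z ∧ D.Adj z x ∧ ∀ y, D.Adj z y → y = x := by
  haveI : Nonempty U := ⟨a⟩
  obtain ⟨u, v, p, hp, hmax⟩ := SimpleGraph.Walk.exists_isPath_forall_isPath_length_le_length D
  have hlen : 1 ≤ p.length := hmax a b hab.toWalk (by
    simp [SimpleGraph.Walk.cons_isPath_iff, hab.ne])
  have hnil : ¬ p.Nil := fun h => by
    rw [SimpleGraph.Walk.nil_iff_length_eq] at h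
    omega
  have huv : u ≠ v := by
    rintro rfl
    apply hnil
    rw [SimpleGraph.Walk.isPath_iff_eq_nil] at hp
    rw [hp]
    exact SimpleGraph.Walk.Nil.nil
  by_cases hu : u ∈ Z
  · have hv : v ∉ Z := fun hv => huv (hZ u hu v hv p.reachable)
    obtain ⟨x, h1, h2⟩ := leaf_start hD hp.reverse (by
      simpa using hmax) (by simpa using hnil)
    exact ⟨v, x, hv, h1, h2⟩
  · obtain ⟨x, h1, h2⟩ := leaf_start hD hp hmax hnil
    exact ⟨u, x, hu, h1, h2⟩

/-- restriction of a graph to a vertex set, with some edges removed -/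
def DW (F : SimpleGraph U) (W : Set U) (E : Set (Sym2 U)) : SimpleGraph U where
  Adj u v := F.Adj u v ∧ u ∈ W ∧ v ∈ W ∧ s(u, v) ∉ E
  symm := ⟨fun u v h => ⟨h.1.symm, h.2.2.1, h.2.1, by rw [Sym2.eq_swap]; exact h.2.2.2⟩⟩
  loopless := ⟨fun u h => h.1.ne rfl⟩

lemma DW_le (F : SimpleGraph U) (W : Set U) (E : Set (Sym2 U)) : DW F W E ≤ F :=
  fun _ _ h => h.1

variable {F : SimpleGraph U} {v : U} {c : F.Walk v v}

lemma mem_support_edge (hc : c.IsCycle) {u : U} (hu : u ∈ c.support) : ∃ w, s(u, w) ∈ c.edges := by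
  obtain ⟨e, he, hue⟩ := (SimpleGraph.Walk.mem_support_iff_exists_mem_edges_of_not_nil hc.not_nil).1 hu
  obtain ⟨w, rfl⟩ := hue
  exact ⟨w, he⟩

lemma DW_acyclic1 (hc : c.IsCycle)
    (huni : ∀ (w : U) (c' : F.Walk w w), c'.IsCycle → ∀ e, e ∈ c'.edges ↔ e ∈ c.edges)
    {W : Set U} (hW : ∃ u ∈ c.support, u ∉ W) : (DW F W ∅).IsAcyclic := by
  intro w c' hc'
  obtain ⟨u, hu, huW⟩ := hW
  obtain ⟨t, ht⟩ := mem_support_edge hc hu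
  have := (huni w (c'.mapLe (DW_le F W ∅)) (hc'.mapLe _) _).2 ht
  rw [SimpleGraph.Walk.edges_mapLe_eq_edges] at this
  have h := c'.edges_subset_edgeSet this
  exact huW h.2.1

lemma DW_acyclic2 (hc : c.IsCycle)
    (huni : ∀ (w : U) (c' : F.Walk w w), c'.IsCycle → ∀ e, e ∈ c'.edges ↔ e ∈ c.edges)
    (W : Set U) : (DW F W {e | e ∈ c.edges}).IsAcyclic := by
  intro w c' hc'
  obtain ⟨t, ht⟩ := mem_support_edge hc c.start_mem_support
  have := (huni w (c'.mapLe (DW_le F W _)) (hc'.mapLe _) _).2 ht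
  rw [SimpleGraph.Walk.edges_mapLe_eq_edges] at this
  have h := c'.edges_subset_edgeSet this
  exact h.2.2.2 ht

lemma DW_reach
    (huni : ∀ (w : U) (c' : F.Walk w w), c'.IsCycle → ∀ e, e ∈ c'.edges ↔ e ∈ c.edges)
    (W : Set U) (a b : U) (ha : a ∈ c.support) (hb : b ∈ c.support)
    (hab : (DW F W {e | e ∈ c.edges}).Reachable a b) : a = b := by
  obtain ⟨p, hp⟩ := hab.exists_isPath
  cases p with
  | nil => rfl
  | cons h q =>
    rename_i t
    exfalso
    have hF : F.Adj a t := h.1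
    have hne : s(a, t) ∉ c.edges := h.2.2.2
    have hbr : F.IsBridge s(a, t) := by
      rw [SimpleGraph.isBridge_iff_forall_cycle_notMem hF]
      intro w c' hc' hmem
      exact hne ((huni w c' hc' _).1 hmem)
    rw [SimpleGraph.isBridge_iff_forall_walk_mem_edges] at hbr
    have hq : s(a, t) ∉ q.edges := by
      intro hmem
      have := q.fst_mem_support_of_mem_edges hmem
      rw [SimpleGraph.Walk.cons_isPath_iff] at hp
      exact hp.2 this
    have h1 := hbr (((c.takeUntil a ha).reverse.append (c.takeUntil b hb)).append
      (q.mapLe (DW_le F W _)).reverse)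
    simp only [SimpleGraph.Walk.edges_append, SimpleGraph.Walk.edges_reverse,
      SimpleGraph.Walk.edges_mapLe_eq_edges, List.mem_append, List.mem_reverse] at h1
    rcases h1 with (h1 | h1) | h1
    · exact hne (c.edges_takeUntil_subset ha h1)
    · exact hne (c.edges_takeUntil_subset hb h1)
    · exact hq h1

end leaf

section simp
variable {V : Type} [Fintype V] {G : SimpleGraph V} {Hset T : Set V}

lemma outside_simp (A : CliqueAttachment G Hset T) {W : Finset V} {u w : V} (hu : u ∈ W)
    (huH : u ∉ Hset) (hw : w ∈ W) (huw : G.Adj u w) : Simp G W u w := by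
  refine ⟨hu, hw, huw, fun y _ y' _ hy hy' => ?_⟩
  rcases A.edges_sub u y hy with h | ⟨i, hi, hyi⟩
  · exact absurd h.1 huH
  rcases A.edges_sub u y' hy' with h | ⟨j, hj, hyj⟩
  · exact absurd h.1 huH
  have hij : i = j := by
    by_contra hne
    have : u = A.a i := A.pairwise_inter i j hne ⟨hi, hj⟩
    exact huH (this ▸ A.T_sub (A.a_mem_T i))
  subst hij
  by_cases h : y = y'
  · exact Or.inl h
  · exact Or.inr (A.clique i hyi hyj h)

variable {v : Hset} {c : (G.induce Hset).Walk v v}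

lemma S1 (A : CliqueAttachment G Hset T) (hc : c.IsCycle)
    (huni : ∀ (w : Hset) (c' : (G.induce Hset).Walk w w), c'.IsCycle →
      ∀ e, e ∈ c'.edges ↔ e ∈ c.edges) (W : Finset V)
    (hW : ¬ { u : V | ∃ h : u ∈ Hset, (⟨u, h⟩ : Hset) ∈ c.support } ⊆ W)
    (hE : ∃ u ∈ W, ∃ v ∈ W, G.Adj u v) : ∃ z x, Simp G W z x := by
  by_cases hout : ∃ u ∈ W, u ∉ Hset ∧ ∃ w ∈ W, G.Adj u w
  · obtain ⟨u, hu, huH, w, hw, huw⟩ := hout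
    exact ⟨u, w, outside_simp A hu huH hw huw⟩
  push Not at hout
  have hin : ∀ u ∈ W, ∀ w ∈ W, G.Adj u w → u ∈ Hset := fun u hu w hw huw => by
    by_contra h
    exact hout u hu h w hw huw
  rw [Set.not_subset] at hW
  obtain ⟨t, ⟨htH, htc⟩, htW⟩ := hW
  obtain ⟨a, ha, b, hb, hab⟩ := hE
  have hac := DW_acyclic1 hc huni (W := {u : Hset | (u : V) ∈ W}) ⟨_, htc, htW⟩
  obtain ⟨z, x, -, hzx, hx⟩ := leaf hac ∅ (by simp)
    (a := ⟨a, hin a ha b hb hab⟩) (b := ⟨b, hin b hb a ha hab.symm⟩)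
    ⟨hab, ha, hb, by simp⟩
  have hu : ∀ y ∈ W, G.Adj z y → y = x := fun y hy hzy => by
    have := hx ⟨y, hin y hy z hzx.2.1 hzy.symm⟩ ⟨hzy, hzx.2.1, hy, by simp⟩
    exact congrArg Subtype.val this
  exact ⟨z, x, hzx.2.1, hzx.2.2.1, hzx.1, fun y hy y' hy' h h' =>
    Or.inl ((hu y hy h).trans (hu y' hy' h').symm)⟩

lemma S2 (A : CliqueAttachment G Hset T) (hc : c.IsCycle)
    (huni : ∀ (w : Hset) (c' : (G.induce Hset).Walk w w), c'.IsCycle →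
      ∀ e, e ∈ c'.edges ↔ e ∈ c.edges) (W : Finset V)
    (hE : ∃ u ∈ W, u ∉ { u : V | ∃ h : u ∈ Hset, (⟨u, h⟩ : Hset) ∈ c.support } ∧
      ∃ v ∈ W, G.Adj u v) :
    ∃ z x, z ∉ { u : V | ∃ h : u ∈ Hset, (⟨u, h⟩ : Hset) ∈ c.support } ∧ Simp G W z x := by
  by_cases hout : ∃ u ∈ W, u ∉ Hset ∧ ∃ w ∈ W, G.Adj u w
  · obtain ⟨u, hu, huH, w, hw, huw⟩ := hout
    exact ⟨u, w, fun h => huH h.1, outside_simp A hu huH hw huw⟩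
  push Not at hout
  have hin : ∀ u ∈ W, ∀ w ∈ W, G.Adj u w → u ∈ Hset := fun u hu w hw huw => by
    by_contra h
    exact hout u hu h w hw huw
  obtain ⟨a, ha, hac, b, hb, hab⟩ := hE
  have hoff : ∀ (u w : Hset), u ∉ c.support → s(u, w) ∉ c.edges := fun u w hu h =>
    hu (c.fst_mem_support_of_mem_edges h)
  obtain ⟨z, x, hz, hzx, hx⟩ := leaf (DW_acyclic2 hc huni {u : Hset | (u : V) ∈ W})
    {u | u ∈ c.support} (fun a ha b hb h => DW_reach huni _ a b ha hb h)
    (a := ⟨a, hin a ha b hb hab⟩) (b := ⟨b, hin b hb a ha hab.symm⟩)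
    ⟨hab, ha, hb, hoff _ _ fun h => hac ⟨_, h⟩⟩
  have hu : ∀ y ∈ W, G.Adj z y → y = x := fun y hy hzy => by
    have := hx ⟨y, hin y hy z hzx.2.1 hzy.symm⟩ ⟨hzy, hzx.2.1, hy, hoff _ _ hz⟩
    exact congrArg Subtype.val this
  exact ⟨z, x, fun h => hz h.2, hzx.2.1, hzx.2.2.1, hzx.1, fun y hy y' hy' h h' =>
    Or.inl ((hu y hy h).trans (hu y' hy' h').symm)⟩

end simp

end RegAux

namespace RegAux
open scoped Classical
open EdgeIdealReg
variable {V K : Type} [Field K]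

lemma im_bdd [Finite V] (G : SimpleGraph V) :
    BddAbove { n | ∃ M, IsInducedMatchingSet G M ∧ M.card = n } := by
  have := Fintype.ofFinite V
  refine ⟨Fintype.card (Sym2 V), ?_⟩
  rintro n ⟨M, -, rfl⟩
  exact Finset.card_le_univ M

lemma im_le [Finite V] {G : SimpleGraph V} {M : Finset (Sym2 V)} (hM : IsInducedMatchingSet G M) :
    M.card ≤ inducedMatchingNumber G := le_csSup (im_bdd G) ⟨M, hM, rfl⟩

lemma im_attained [Finite V] (G : SimpleGraph V) :
    ∃ M, IsInducedMatchingSet G M ∧ M.card = inducedMatchingNumber G :=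
  Nat.sSup_mem (s := { n | ∃ M, IsInducedMatchingSet G M ∧ M.card = n })
    ⟨0, ∅, by simp [IsInducedMatchingSet, IsMatchingSet], rfl⟩ (im_bdd G)

lemma im_induce [Finite V] {G : SimpleGraph V} (s : Set V) {M : Finset (Sym2 V)}
    (hM : IsInducedMatchingSet G M) (hs : ∀ e ∈ M, ∀ v ∈ e, v ∈ s) :
    M.card ≤ inducedMatchingNumber (G.induce s) := by
  have := Fintype.ofFinite V
  have hinj : Function.Injective (Sym2.map (Subtype.val : s → V)) :=
    Sym2.map.injective Subtype.val_injective
  obtain ⟨M', hM'⟩ : ∃ M' : Finset (Sym2 s), M' = Finset.univ.filter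
    (fun e => Sym2.map Subtype.val e ∈ M) := ⟨_, rfl⟩
  have hmem : ∀ e, e ∈ M' ↔ Sym2.map Subtype.val e ∈ M := fun e => by rw [hM']; simp
  have hcard : M'.image (Sym2.map Subtype.val) = M := by
    ext e
    rw [Finset.mem_image]
    constructor
    · rintro ⟨e', he', rfl⟩
      exact (hmem e').1 he'
    · intro he
      induction e with
      | h a b =>
        exact ⟨s(⟨a, hs _ he a (by simp)⟩, ⟨b, hs _ he b (by simp)⟩),
          (hmem _).2 (by simpa using he), by simp⟩
  rw [← hcard, Finset.card_image_of_injective _ hinj]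
  have hin : ∀ (e : Sym2 s) (v : s), v ∈ e → (v : V) ∈ Sym2.map Subtype.val e := fun e v hv =>
    Sym2.mem_map.2 ⟨v, hv, rfl⟩
  refine im_le ⟨⟨?_, ?_⟩, ?_⟩
  · intro e he
    have h := hM.1.1 ((hmem e).1 he)
    induction e with
    | h a b => exact h
  · intro e he f hf hne v hve hvf
    exact hM.1.2 ((hmem e).1 he) ((hmem f).1 hf) (fun h => hne (hinj h)) v (hin e v hve)
      (hin f v hvf)
  · intro e he f hf hne u v hue hvf huv
    exact hM.2 ((hmem e).1 he) ((hmem f).1 hf) (fun h => hne (hinj h)) u v (hin e u hue)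
      (hin f v hvf) huv

lemma edgeIdeal_ne_top (G : SimpleGraph V) : edgeIdeal K G ≠ ⊤ := by
  intro h
  have hle : edgeIdeal K G ≤ RingHom.ker (constantCoeff (σ := V) (R := K)) := by
    refine Ideal.span_le.2 ?_
    rintro p ⟨u, v, -, rfl⟩
    show constantCoeff (X u * X v) = (0 : K)
    simp
  have h1 : (1 : MvPolynomial V K) ∈ edgeIdeal K G := by rw [h]; trivial
  have h2 : constantCoeff (1 : MvPolynomial V K) = (0 : K) := hle h1
  simp at h2

lemma edgeIdeal_eq_on [Fintype V] (G : SimpleGraph V) :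
    edgeIdeal K G = edgeIdealOn K G ((Finset.univ : Finset V) : Set V) := by
  unfold edgeIdeal edgeIdealOn
  simp

lemma mem_outΓ {G : SimpleGraph V} {cyc : Set V} {W : Finset V} {w : V}
    (h : w ∈ outΓ G cyc W) : w ∈ cyc ∨ ∀ y ∈ cyc, ¬ G.Adj y w := (Finset.mem_filter.1 h).2

end RegAux

open EdgeIdealReg in
/-- Let `H` be unicyclic with cycle `C` of length `n ≡ 2 (mod 3)` and `G = H_T` obtained by
attaching unions of complete graphs at vertices of `T ⊆ V(H)`.  Let `Γ(G)` be the set of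
neighbors, outside the cycle, of the cycle vertices (the union of the neighborhoods of the
attachment vertices inside the attached chordal graphs).  If `ν(G ∖ Γ(G)) < ν(G)`, then
`reg(S/I(G)) = ν(G)`. -/
theorem reg_unicyclic_attached_eq_nu_of_gamma {V K : Type} [Field K] [Fintype V] [DecidableEq V]
    (G : SimpleGraph V) (Hset T : Set V) (huni : Unicyclic (G.induce Hset))
    (hatt : Nonempty (CliqueAttachment G Hset T))
    (v : Hset) (c : (G.induce Hset).Walk v v) (hc : c.IsCycle) (hlen : c.length % 3 = 2)
    (cycV Γ : Set V)
    (hcycV : cycV = { u : V | ∃ h : u ∈ Hset, (⟨u, h⟩ : Hset) ∈ c.support })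
    (hΓ : Γ = { w : V | w ∉ cycV ∧ ∃ y ∈ cycV, G.Adj y w })
    (hν : inducedMatchingNumber (G.induce (Γᶜ : Set V)) < inducedMatchingNumber G) :
    regQuot (edgeIdeal K G) = (((inducedMatchingNumber G : ℤ)) : WithBot ℤ) := by
  obtain ⟨A⟩ := hatt
  obtain ⟨v0, c0, -, h0⟩ := huni
  have hu : ∀ (w : Hset) (c' : (G.induce Hset).Walk w w), c'.IsCycle →
      ∀ e, e ∈ c'.edges ↔ e ∈ c.edges := fun w c' hc' e => by
    have := (h0 w c' hc').trans (h0 v c hc).symm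
    exact Set.ext_iff.1 this e
  have hres : RegAux.Res (edgeIdeal K G) (inducedMatchingNumber G) := by
    rw [RegAux.edgeIdeal_eq_on]
    refine RegAux.main_res G cycV ?_ ?_ ?_ _ Finset.univ _ rfl (by simp) ?_ ?_
    · exact ⟨v, by rw [hcycV]; exact ⟨v.2, c.start_mem_support⟩⟩
    · intro W hW hE
      rw [hcycV] at hW
      exact RegAux.S1 A hc hu W hW hE
    · intro W _ hE
      rw [hcycV] at hE ⊢
      exact RegAux.S2 A hc hu W hE
    · exact fun M hM => RegAux.im_le hM.1
    · intro M hM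
      refine lt_of_le_of_lt (RegAux.im_induce (Γᶜ : Set V) hM.1 fun e he w hw => ?_) hν
      have hw2 := RegAux.mem_outΓ (hM.2 e he w hw)
      rw [hΓ]
      rintro ⟨h1, y, hy, hyw⟩
      rcases hw2 with h | h
      · exact h1 h
      · exact h y hy hyw
  rw [regQuot, if_neg (RegAux.edgeIdeal_ne_top G)]
  congr 1
  apply IsLeast.csInf_eq
  refine ⟨hres.toResolution, ?_⟩
  rintro d ⟨F, hF⟩
  obtain ⟨M, hM, hcard⟩ := RegAux.im_attained G
  rw [← hcard]
  exact RegAux.lower_bound G F d hF M hM
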